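/- arXiv:1902.09488 — 5 statements merged into one kernel-verified Lean document; each statement's English description precedes it below -/
import Mathlib

section
/- (Euler–Lagrange equation and transversality condition.) Fix T > 0, a probability kernel (μ_t)_{t∈[0,T]} from [0,T] to ℝ, and Borel functions J : [0,T] × ℝ × ℝ → ℝ, Φ : ℝ × ℝ → ℝ satisfying assumptions A1–A6. If F* ∈ 𝒜 is a minimizer of 𝒥 over 𝒜, then ∫_ℝ (∂J/∂x)(t, z, F*(t)) dμ_t(z) = 0 for almost every t ∈ (0,T), and ∫_ℝ (∂Φ/∂x)(z, F*(T)) dμ_T(z) = 0. -/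
open MeasureTheory Set
open scoped ENNReal NNReal

noncomputable section

/-- `F` is absolutely continuous on `[0,T]` with `F 0 = 0`. -/
def AbsContZero (T : ℝ) (F : ℝ → ℝ) : Prop :=
  ∃ f : ℝ → ℝ, IntegrableOn f (Set.Ioc 0 T) ∧
    ∀ t ∈ Set.Icc (0:ℝ) T, F t = ∫ s in (0:ℝ)..t, f s

/-- The cost functional `𝒥[F]`, valued in `ℝ≥0∞` (`J, Φ ≥ 0`). -/
def cost (T : ℝ) (κ : ProbabilityTheory.Kernel ℝ ℝ)
    (J : ℝ → ℝ → ℝ → ℝ) (Φ : ℝ → ℝ → ℝ) (F : ℝ → ℝ) : ℝ≥0∞ :=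
  (∫⁻ t in Set.Ioc 0 T, ∫⁻ z, ENNReal.ofReal (J t z (F t)) ∂(κ t)) +
    ∫⁻ z, ENNReal.ofReal (Φ z (F T)) ∂(κ T)


theorem gen_aux {α : Type*} [MeasurableSpace α] (m : Measure α) (G : α → ℝ → ℝ)
    (hG : Measurable fun p : α × ℝ => G p.1 p.2) (hpos : ∀ a x, 0 ≤ G a x)
    (hC : ∀ a, ContDiff ℝ 1 (G a)) (u v : α → ℝ) (hu : Measurable u) (hv : Measurable v)
    (R M : ℝ) (hR : ∀ᵐ a ∂m, |u a| ≤ R) (hM : ∀ᵐ a ∂m, |v a| ≤ M) (Ψ : α → ℝ)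
    (hΨ : Integrable Ψ m)
    (hb : ∀ᵐ a ∂m, ∀ x ∈ Icc (-(R + M)) (R + M), |deriv (G a) x| ≤ Ψ a)
    (hfin : ∫⁻ a, ENNReal.ofReal (G a (u a)) ∂m ≠ ⊤) :
    Integrable (fun a => deriv (G a) (u a) * v a) m ∧
    HasDerivAt (fun ε : ℝ => ∫ a, G a (u a + ε * v a) ∂m) (∫ a, deriv (G a) (u a) * v a ∂m) 0 ∧
    ∀ ε ∈ Metric.ball (0:ℝ) 1, ENNReal.ofReal (∫ a, G a (u a + ε * v a) ∂m) =
      ∫⁻ a, ENNReal.ofReal (G a (u a + ε * v a)) ∂m := by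
  have hdiff : ∀ a, Differentiable ℝ (G a) := fun a => (hC a).differentiable (by norm_num)
  have hmeas : ∀ ε : ℝ, Measurable fun a => G a (u a + ε * v a) := fun ε =>
    hG.comp (measurable_id.prodMk (hu.add (hv.const_mul ε)))
  have hmeas0 : Measurable fun a => G a (u a) := hG.comp (measurable_id.prodMk hu)
  have hint0 : Integrable (fun a => G a (u a)) m := by
    have := integrable_toReal_of_lintegral_ne_top hmeas0.ennreal_ofReal.aemeasurable hfin
    refine this.congr (Filter.Eventually.of_forall fun a => ?_)
    exact ENNReal.toReal_ofReal (hpos _ _)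
  have hmem : ∀ a, |u a| ≤ R → |v a| ≤ M → ∀ ε ∈ Metric.ball (0:ℝ) 1,
      u a + ε * v a ∈ Icc (-(R + M)) (R + M) := by
    intro a h1 h2 ε hε
    rw [mem_ball_zero_iff, Real.norm_eq_abs] at hε
    refine abs_le.1 ?_
    have h3 : |ε * v a| ≤ M := by
      rw [abs_mul]
      nlinarith [abs_nonneg (v a), abs_nonneg ε]
    exact (abs_add_le _ _).trans (by linarith)
  have hdm : Measurable fun a => deriv (G a) (u a) := by
    refine measurable_of_tendsto_metrizable
      (f := fun (n : ℕ) a => ((n:ℝ) + 1) * (G a (u a + 1 / ((n:ℝ) + 1)) - G a (u a))) ?_ ?_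
    · intro n
      refine Measurable.const_mul (Measurable.sub ?_ hmeas0) _
      exact hG.comp (measurable_id.prodMk (hu.add_const _))
    · rw [tendsto_pi_nhds]
      intro a
      have h := (hdiff a (u a)).hasDerivAt.tendsto_slope_zero
      have h2 : Filter.Tendsto (fun n : ℕ => 1 / ((n:ℝ) + 1)) Filter.atTop
          (nhdsWithin 0 {0}ᶜ) := by
        refine tendsto_nhdsWithin_iff.2 ⟨tendsto_one_div_add_atTop_nhds_zero_nat, ?_⟩
        refine Filter.Eventually.of_forall fun n => ?_
        have : (0:ℝ) < 1 / ((n:ℝ) + 1) := by positivity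
        exact this.ne'
      refine (h.comp h2).congr fun n => ?_
      simp
  have hint : ∀ ε ∈ Metric.ball (0:ℝ) 1, Integrable (fun a => G a (u a + ε * v a)) m := by
    intro ε hε
    have : Integrable (fun a => G a (u a) + Ψ a * M) m := hint0.add (hΨ.mul_const M)
    refine this.mono' (hmeas ε).aestronglyMeasurable ?_
    filter_upwards [hR, hM, hb] with a h1 h2 h3
    have k0 := hmem a h1 h2 0 (by simp)
    have k1 := hmem a h1 h2 ε hε
    have k := (convex_Icc (-(R + M)) (R + M)).norm_image_sub_le_of_norm_deriv_le
      (fun x _ => hdiff a x) h3 k0 k1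
    rw [Real.norm_eq_abs, Real.norm_eq_abs] at k
    have e : u a + ε * v a - (u a + 0 * v a) = ε * v a := by ring
    rw [e, abs_mul, zero_mul, add_zero] at k
    rw [mem_ball_zero_iff, Real.norm_eq_abs] at hε
    have hΨ0 : 0 ≤ Ψ a := (abs_nonneg _).trans (h3 _ k0)
    have k2 : |ε| * |v a| ≤ M := by nlinarith [abs_nonneg (v a), abs_nonneg ε]
    have k3 := mul_le_mul_of_nonneg_left k2 hΨ0
    rw [Real.norm_eq_abs, abs_of_nonneg (hpos _ _)]
    have := (abs_le.1 k).2
    linarith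
  have main := hasDerivAt_integral_of_dominated_loc_of_deriv_le (μ := m)
    (F := fun (ε : ℝ) a => G a (u a + ε * v a))
    (F' := fun (ε : ℝ) a => deriv (G a) (u a + ε * v a) * v a) (x₀ := (0:ℝ))
    (bound := fun a => Ψ a * M)
    (Metric.ball_mem_nhds (0:ℝ) one_pos)
    (Filter.Eventually.of_forall fun ε => (hmeas ε).aestronglyMeasurable)
    (hint 0 (by simp))
    (by simp only [zero_mul, add_zero]; exact (hdm.mul hv).aestronglyMeasurable)
    (by
      filter_upwards [hR, hM, hb] with a h1 h2 h3 ε hε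
      have h4 := h3 _ (hmem a h1 h2 ε hε)
      rw [norm_mul]
      exact mul_le_mul h4 h2 (norm_nonneg _) ((abs_nonneg _).trans h4))
    (hΨ.mul_const M)
    (by
      refine Filter.Eventually.of_forall fun a ε _ => ?_
      have h1 : HasDerivAt (fun ε : ℝ => u a + ε * v a) (v a) ε := by
        simpa using ((hasDerivAt_id ε).mul_const (v a)).const_add (u a)
      exact (hdiff a _).hasDerivAt.comp ε h1)
  simp only [zero_mul, add_zero] at main
  refine ⟨main.1, main.2, fun ε hε => ?_⟩
  exact ofReal_integral_eq_lintegral_ofReal (hint ε hε)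
    (Filter.Eventually.of_forall fun a => hpos _ _)

/-- Euler–Lagrange equation and transversality condition for a minimizer of
`𝒥` over `𝒜`, under assumptions A1–A6. -/
theorem stmt_4 (T : ℝ) (hT : 0 < T)
    (κ : ProbabilityTheory.Kernel ℝ ℝ) [ProbabilityTheory.IsMarkovKernel κ]
    (J : ℝ → ℝ → ℝ → ℝ) (Φ : ℝ → ℝ → ℝ)
    (hJmeas : Measurable fun p : ℝ × ℝ × ℝ => J p.1 p.2.1 p.2.2)
    (hΦmeas : Measurable fun p : ℝ × ℝ => Φ p.1 p.2)
    -- A1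
    (A1 : ∃ F, AbsContZero T F ∧ cost T κ J Φ F < ⊤)
    -- A2
    (A2J : ∀ t z x, 0 ≤ J t z x) (A2Φ : ∀ z x, 0 ≤ Φ z x)
    -- A3
    (A3 : ∀ t z, ContDiff ℝ 1 (J t z))
    -- A4
    (A4 : ∀ K : Set ℝ, IsCompact K → ∃ Ψ : ℝ → ℝ → ℝ,
      Measurable (Function.uncurry Ψ) ∧
      (∫⁻ t in Set.Ioc 0 T, ∫⁻ z, ENNReal.ofReal (Ψ t z) ∂(κ t)) < ⊤ ∧
      ∀ t ∈ Set.Icc (0:ℝ) T, ∀ z : ℝ, ∀ x ∈ K, |deriv (J t z) x| ≤ Ψ t z)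
    -- A5
    (A5 : ∀ z, ContDiff ℝ 1 (Φ z))
    -- A6
    (A6 : ∀ K : Set ℝ, IsCompact K → ∃ Θ : ℝ → ℝ,
      Integrable Θ (κ T) ∧ ∀ z : ℝ, ∀ x ∈ K, |deriv (Φ z) x| ≤ Θ z)
    -- F* is a minimizer of 𝒥 over 𝒜
    (Fstar : ℝ → ℝ) (hFstar : AbsContZero T Fstar)
    (hmin : ∀ G, AbsContZero T G → cost T κ J Φ Fstar ≤ cost T κ J Φ G) :
    (∀ᵐ t ∂(volume.restrict (Set.Ioo 0 T)), ∫ z, deriv (J t z) (Fstar t) ∂(κ t) = 0) ∧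
      ∫ z, deriv (Φ z) (Fstar T) ∂(κ T) = 0 := by
  classical
  obtain ⟨f, hf, hFf⟩ := id hFstar
  have hfi : IntervalIntegrable f volume 0 T :=
    (intervalIntegrable_iff_integrableOn_Ioc_of_le hT.le).2 hf
  have hFcont : ContinuousOn Fstar (Icc 0 T) := by
    have := intervalIntegral.continuousOn_primitive_interval' hfi left_mem_uIcc
    rw [uIcc_of_le hT.le] at this
    exact this.congr hFf
  obtain ⟨F0, hF0c, hF0⟩ : ∃ F0 : ℝ → ℝ, Continuous F0 ∧ ∀ t ∈ Icc (0:ℝ) T, F0 t = Fstar t := by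
    refine ⟨IccExtend hT.le ((Icc 0 T).domRestrict Fstar), hFcont.domRestrict.Icc_extend', ?_⟩
    intro t ht
    rw [IccExtend_of_mem _ _ ht]
    rfl
  have hTm : T ∈ Icc (0:ℝ) T := right_mem_Icc.2 hT.le
  have bdd : ∀ η : ℝ → ℝ, Continuous η → ∃ M, ∀ t ∈ Icc (0:ℝ) T, |η t| ≤ M := fun η hη =>
    isCompact_Icc.exists_bound_of_continuousOn (f := η) hη.continuousOn
  obtain ⟨R, hR⟩ := bdd F0 hF0c
  have hcost : cost T κ J Φ Fstar < ⊤ := by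
    obtain ⟨F, h1, h2⟩ := A1
    exact (hmin F h1).trans_lt h2
  set ν : Measure ℝ := volume.restrict (Ioc 0 T) with hν
  set m : Measure (ℝ × ℝ) := ν.compProd κ with hm
  have haem : ∀ᵐ p ∂m, p.1 ∈ Ioc (0:ℝ) T :=
    Measure.ae_compProd_of_ae_fst κ measurableSet_Ioc (ae_restrict_mem measurableSet_Ioc)
  have hJm : ∀ u : ℝ → ℝ, Continuous u →
      Measurable fun p : ℝ × ℝ => J p.1 p.2 (u p.1) := fun u hu =>
    hJmeas.comp (measurable_fst.prodMk (measurable_snd.prodMk (hu.measurable.comp measurable_fst)))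
  -- cost in terms of `m`
  have cost_eq : ∀ F u : ℝ → ℝ, Continuous u → (∀ t ∈ Icc (0:ℝ) T, u t = F t) →
      cost T κ J Φ F = ∫⁻ p, ENNReal.ofReal (J p.1 p.2 (u p.1)) ∂m +
        ∫⁻ z, ENNReal.ofReal (Φ z (u T)) ∂(κ T) := by
    intro F u hu h
    unfold cost
    rw [h T hTm, hm, Measure.lintegral_compProd (hJm u hu).ennreal_ofReal]
    congr 1
    refine setLIntegral_congr_fun measurableSet_Ioc fun t ht => ?_
    simp only [h t (Ioc_subset_Icc_self ht)]
  have hfin := hcost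
  rw [cost_eq Fstar F0 hF0c hF0, ENNReal.add_lt_top] at hfin
  have key : ∀ η : ℝ → ℝ, ContDiff ℝ 1 η → η 0 = 0 →
      Integrable (fun p : ℝ × ℝ => deriv (J p.1 p.2) (F0 p.1) * η p.1) m ∧
      ∫ p, deriv (J p.1 p.2) (F0 p.1) * η p.1 ∂m + (∫ z, deriv (Φ z) (F0 T) ∂(κ T)) * η T = 0 := by
    intro η hη hη0
    obtain ⟨M, hM⟩ := bdd η hη.continuous
    obtain ⟨Ψ, hΨm, hΨi, hΨb⟩ := A4 (Icc (-(R + M)) (R + M)) isCompact_Icc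
    obtain ⟨Θ, hΘi, hΘb⟩ := A6 (Icc (-(R + M)) (R + M)) isCompact_Icc
    have hΨi' : Integrable (fun p : ℝ × ℝ => (ENNReal.ofReal (Ψ p.1 p.2)).toReal) m := by
      have hmm : Measurable fun p : ℝ × ℝ => ENNReal.ofReal (Ψ p.1 p.2) := hΨm.ennreal_ofReal
      refine integrable_toReal_of_lintegral_ne_top hmm.aemeasurable ?_
      rw [hm, Measure.lintegral_compProd hmm]
      exact hΨi.ne
    obtain ⟨i1, d1, e1⟩ := gen_aux m (fun p : ℝ × ℝ => J p.1 p.2)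
      (hJmeas.comp ((measurable_fst.comp measurable_fst).prodMk
        ((measurable_snd.comp measurable_fst).prodMk measurable_snd)))
      (fun p x => A2J _ _ _) (fun p => A3 _ _) (fun p => F0 p.1) (fun p => η p.1)
      (hF0c.measurable.comp measurable_fst) (hη.continuous.measurable.comp measurable_fst) R M
      (haem.mono fun p hp => hR _ (Ioc_subset_Icc_self hp))
      (haem.mono fun p hp => hM _ (Ioc_subset_Icc_self hp)) _ hΨi'
      (haem.mono fun p hp x hx => (hΨb _ (Ioc_subset_Icc_self hp) _ x hx).trans
        (by rw [ENNReal.toReal_ofReal']; exact le_max_left _ _))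
      hfin.1.ne
    obtain ⟨i2, d2, e2⟩ := gen_aux (κ T) Φ hΦmeas A2Φ A5 (fun _ => F0 T) (fun _ => η T)
      measurable_const measurable_const R M (Filter.Eventually.of_forall fun _ => hR T hTm)
      (Filter.Eventually.of_forall fun _ => hM T hTm) Θ hΘi
      (Filter.Eventually.of_forall fun z x hx => hΘb z x hx) hfin.2.ne
    refine ⟨i1, ?_⟩
    rw [← integral_mul_const]
    refine IsLocalMin.hasDerivAt_eq_zero ?_ (d1.add d2)
    filter_upwards [Metric.ball_mem_nhds (0:ℝ) one_pos] with ε hε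
    have hac : AbsContZero T (fun t => Fstar t + ε * η t) := by
      have hdc : Continuous (deriv η) := hη.continuous_deriv le_rfl
      refine ⟨fun s => f s + ε * deriv η s, hf.add
        ((hdc.const_smul ε).integrableOn_Ioc), fun t ht => ?_⟩
      have hft : IntervalIntegrable f volume 0 t := hfi.mono_set (by
        rw [uIcc_of_le hT.le, uIcc_of_le ht.1]; exact Icc_subset_Icc_right ht.2)
      have hg : IntervalIntegrable (fun s => ε * deriv η s) volume 0 t :=
        (hdc.const_smul ε).intervalIntegrable _ _
      simp only
      rw [intervalIntegral.integral_add hft hg,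
        intervalIntegral.integral_const_mul, intervalIntegral.integral_deriv_eq_sub
          (fun x _ => hη.differentiable (by norm_num) x) (hdc.intervalIntegrable _ _),
        hη0, sub_zero, ← hFf t ht]
    have hle := hmin _ hac
    rw [cost_eq Fstar F0 hF0c hF0, cost_eq _ (fun t => F0 t + ε * η t)
      (hF0c.add (hη.continuous.const_smul ε)) (fun t ht => by rw [hF0 t ht])] at hle
    have q1 := e1 ε hε
    have q2 := e2 ε hε
    have r1 := e1 0 (by simp)
    have r2 := e2 0 (by simp)
    simp only [zero_mul, add_zero] at r1 r2
    rw [← q1, ← q2, ← r1, ← r2, ← ENNReal.ofReal_add (integral_nonneg fun p => A2J _ _ _)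
      (integral_nonneg fun p => A2Φ _ _), ← ENNReal.ofReal_add
      (integral_nonneg fun p => A2J _ _ _) (integral_nonneg fun p => A2Φ _ _),
      ENNReal.ofReal_le_ofReal_iff (add_nonneg (integral_nonneg fun p => A2J _ _ _)
      (integral_nonneg fun p => A2Φ _ _))] at hle
    simpa using hle
  have key2 : ∀ η : ℝ → ℝ, ContDiff ℝ 1 η → η 0 = 0 →
      (∫ t in Ioc 0 T, η t * (∫ z, deriv (J t z) (F0 t) ∂(κ t))) +
        (∫ z, deriv (Φ z) (F0 T) ∂(κ T)) * η T = 0 := by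
    intro η hη hη0
    obtain ⟨h1, h2⟩ := key η hη hη0
    rw [hm, Measure.integral_compProd h1] at h2
    refine Eq.trans ?_ h2
    congr 1
    refine integral_congr_ae (Filter.Eventually.of_forall fun t => ?_)
    simp only
    rw [integral_mul_const, mul_comm]
  have hloc : LocallyIntegrableOn (fun t => t * ∫ z, deriv (J t z) (F0 t) ∂(κ t)) (Ioo 0 T) := by
    have h1 : Integrable _ _ := (key (fun t => t) contDiff_id rfl).1
    have h2 : IntegrableOn (fun t => t * ∫ z, deriv (J t z) (F0 t) ∂(κ t)) (Ioc 0 T) := by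
      have := MeasureTheory.Integrable.integral_compProd
        (κ := ProbabilityTheory.Kernel.const Unit ν)
        (η := ProbabilityTheory.Kernel.prodMkLeft Unit κ) (a := ()) h1
      refine Integrable.congr (μ := ν) this (Filter.Eventually.of_forall fun t => ?_)
      simp only [ProbabilityTheory.Kernel.prodMkLeft_apply]
      rw [integral_mul_const, mul_comm]
    exact (h2.mono_set Ioo_subset_Ioc_self).locallyIntegrableOn
  have hae : ∀ᵐ t ∂volume, t ∈ Ioo 0 T → ∫ z, deriv (J t z) (F0 t) ∂(κ t) = 0 := by
    have hae' := isOpen_Ioo.ae_eq_zero_of_integral_contDiff_smul_eq_zero hloc (by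
      intro η hη _ hs
      have z0 : ∀ t, t ∉ Ioo 0 T → η t = 0 := fun t ht =>
        image_eq_zero_of_notMem_tsupport fun h => ht (hs h)
      have hη1 : ContDiff ℝ 1 η := hη.of_le (by exact_mod_cast le_top)
      have := key2 (fun t => η t * t) (hη1.mul contDiff_id) (by simp)
      rw [z0 T (by simp), zero_mul, mul_zero, add_zero] at this
      refine Eq.trans ?_ this
      symm
      simp only [smul_eq_mul, mul_assoc]
      refine setIntegral_eq_integral_of_forall_compl_eq_zero fun t ht => ?_
      rw [z0 t fun h => ht (Ioo_subset_Ioc_self h), zero_mul])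
    filter_upwards [hae'] with t ht h
    exact (mul_eq_zero.1 (ht h)).resolve_left h.1.ne'
  constructor
  · rw [ae_restrict_iff' measurableSet_Ioo]
    filter_upwards [hae] with t ht h
    rw [← hF0 t (Ioo_subset_Icc_self h)]
    exact ht h
  · have h := key2 (fun t => t) contDiff_id rfl
    have h0 : ∫ t in Ioc 0 T, t * (∫ z, deriv (J t z) (F0 t) ∂(κ t)) = 0 := by
      rw [integral_Ioc_eq_integral_Ioo]
      refine setIntegral_eq_zero_of_ae_eq_zero ?_
      filter_upwards [hae] with t ht h
      rw [ht h, mul_zero]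
    rw [h0, zero_add, hF0 T hTm] at h
    exact (mul_eq_zero.1 h).resolve_right hT.ne'
end
end

section
/- (Power cost functionals, p > 2.) Let (Ω,ℱ,ℙ) be a probability space, T > 0, a ∈ L¹(0,T) with A(t) = ∫₀ᵗ a(s) ds, and let z : [0,T] × Ω → ℝ be jointly measurable with almost surely Lebesgue-integrable sample paths; define Z(t) = e^{A(t)} ∫₀ᵗ z(s) e^{−A(s)} ds. Fix p > 2 and suppose: (i) E[|z(t)|^p] < ∞ for every t; (ii) t ↦ E[|z(t)|^p] belongs to L¹(0,T); (iii) z(t) > 0 almost surely for every t ∈ (0,T]; (iv) the function (t,x) ↦ (∂/∂t) E[|x − Z(t)|^{p−2}(x − Z(t))] exists and is continuous. Then for every constant C ≥ 0 the functional 𝒥_p[F] = E[∫₀ᵀ |Z(t) − F(t)|^p dt] + C admits a unique minimizer F_p over 𝒜 = {F : [0,T] → ℝ absolutely continuous, F(0) = 0}, and F_p is the unique function in 𝒜 satisfying E[|F_p(t) − Z(t)|^{p−2}(F_p(t) − Z(t))] = 0 for every t ∈ (0,T). The same existence and uniqueness holds for the functional E[∫₀ᵀ |Z(t) − F(t)|^p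 dt + |Z(T) − F(T)|^p]. -/
open MeasureTheory Set
open scoped ENNReal NNReal

noncomputable section

/-- The running power cost `E[∫₀ᵀ |Z(t) − F(t)|^p dt]`, valued in `ℝ≥0∞`. -/
def powRunCost {Ω : Type*} [MeasurableSpace Ω] (P : Measure Ω) (T p : ℝ)
    (Z : ℝ → Ω → ℝ) (F : ℝ → ℝ) : ℝ≥0∞ :=
  ∫⁻ ω, (∫⁻ t in Set.Ioc 0 T, ENNReal.ofReal (|Z t ω - F t| ^ p)) ∂P

/-- The terminal power cost `E[|Z(T) − F(T)|^p]`, valued in `ℝ≥0∞`. -/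
def powTermCost {Ω : Type*} [MeasurableSpace Ω] (P : Measure Ω) (T p : ℝ)
    (Z : ℝ → Ω → ℝ) (F : ℝ → ℝ) : ℝ≥0∞ :=
  ∫⁻ ω, ENNReal.ofReal (|Z T ω - F T| ^ p) ∂P

set_option linter.unusedSectionVars false
set_option linter.unusedVariables false

def psi (p u : ℝ) : ℝ := |u| ^ (p - 2) * u

lemma psi_neg (p u : ℝ) : psi p (-u) = - psi p u := by simp [psi]

lemma psi_nonneg_eq {p u : ℝ} (hp : 2 < p) (hu : 0 ≤ u) : psi p u = u ^ (p - 1) := by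
  unfold psi
  rw [abs_of_nonneg hu]
  rcases hu.eq_or_lt with rfl | h
  · rw [mul_zero, Real.zero_rpow (by linarith)]
  · rw [← Real.rpow_add_one h.ne']; congr 1; ring

lemma psi_nonneg {p u : ℝ} (hu : 0 ≤ u) : 0 ≤ psi p u := by
  unfold psi; positivity

lemma rpow_split {p u : ℝ} (hp : 2 < p) (hu : 0 ≤ u) : u ^ (p - 1) = u ^ (p - 2) * u := by
  rw [← psi_nonneg_eq hp hu, psi, abs_of_nonneg hu]

lemma psi_continuous {p : ℝ} (hp : 2 < p) : Continuous (psi p) := by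
  unfold psi
  exact (continuous_abs.rpow_const (fun _ => Or.inr (by linarith))).mul continuous_id

lemma psi_abs (p u : ℝ) : |psi p u| = |u| ^ (p-2) * |u| := by
  unfold psi; rw [abs_mul, abs_of_nonneg (by positivity : (0:ℝ) ≤ |u| ^ (p-2))]

lemma psi_abs' {p u : ℝ} (hp : 2 < p) : |psi p u| = |u| ^ (p-1) := by
  rw [psi_abs, rpow_split hp (abs_nonneg u)]

/-- lower bound, weight at the upper point -/
lemma psi_lower {p u v : ℝ} (hp : 2 < p) (h : v ≤ u) :
    |u| ^ (p-2) * (u - v) / 2 ≤ psi p u - psi p v := by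
  rcases le_total 0 v with hv | hv
  · have hu : 0 ≤ u := hv.trans h
    have h1 : v ^ (p-2) ≤ u ^ (p-2) := Real.rpow_le_rpow hv h (by linarith)
    rw [psi, psi, abs_of_nonneg hu, abs_of_nonneg hv]
    have h2 : 0 ≤ u ^ (p-2) := by positivity
    nlinarith [mul_nonneg h2 (sub_nonneg.2 h), mul_le_mul_of_nonneg_right h1 hv]
  · rcases le_total 0 u with hu | hu
    · obtain ⟨w, rfl⟩ : ∃ w, v = -w := ⟨-v, by ring⟩
      have hw : 0 ≤ w := by linarith
      rw [psi, psi, abs_neg, abs_of_nonneg hu, abs_of_nonneg hw]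
      have h2 : 0 ≤ u ^ (p-2) := by positivity
      have h3 : 0 ≤ w ^ (p-2) := by positivity
      rcases le_total u w with huw | huw
      · have h1 : u ^ (p-2) ≤ w ^ (p-2) := Real.rpow_le_rpow hu huw (by linarith)
        nlinarith [mul_le_mul_of_nonneg_right h1 hw, mul_nonneg h2 hu, mul_nonneg h3 hw]
      · nlinarith [mul_le_mul_of_nonneg_left huw h2, mul_nonneg h2 hu, mul_nonneg h3 hw]
    · obtain ⟨w, rfl⟩ : ∃ w, v = -w := ⟨-v, by ring⟩
      obtain ⟨x, rfl⟩ : ∃ w, u = -w := ⟨-u, by ring⟩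
      have hw : 0 ≤ w := by linarith
      have hx : 0 ≤ x := by linarith
      have hxw : x ≤ w := by linarith
      rw [psi, psi, abs_neg, abs_neg, abs_of_nonneg hx, abs_of_nonneg hw]
      have h1 : x ^ (p-2) ≤ w ^ (p-2) := Real.rpow_le_rpow hx hxw (by linarith)
      have h2 : 0 ≤ x ^ (p-2) := by positivity
      nlinarith [mul_le_mul_of_nonneg_right h1 hw, mul_nonneg h2 (sub_nonneg.2 hxw)]

lemma psi_lower' {p u v : ℝ} (hp : 2 < p) (h : v ≤ u) :
    |v| ^ (p-2) * (u - v) / 2 ≤ psi p u - psi p v := by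
  have := psi_lower (u := -v) (v := -u) hp (by linarith)
  rw [psi_neg, psi_neg, abs_neg] at this
  linarith

lemma psi_strictMono {p : ℝ} (hp : 2 < p) : StrictMono (psi p) := by
  intro v u h
  have h1 := psi_lower hp h.le
  have h2 := psi_lower' hp h.le
  rcases eq_or_ne u 0 with rfl | hu
  · have : 0 < |v| ^ (p-2) := Real.rpow_pos_of_pos (abs_pos.2 h.ne) _
    nlinarith [mul_pos this (sub_pos.2 h)]
  · have : 0 < |u| ^ (p-2) := Real.rpow_pos_of_pos (abs_pos.2 hu) _
    nlinarith [mul_pos this (sub_pos.2 h)]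

/-- tangent line inequality -/
lemma tangent {q : ℝ} (hq : 1 < q) (u v : ℝ) :
    |u| ^ q + q * (|u| ^ (q-2) * u) * (v - u) ≤ |v| ^ q := by
  have hconj : q.HolderConjugate (q / (q-1)) := Real.HolderConjugate.conjExponent hq
  have hy := Real.young_inequality v (|u| ^ (q-2) * u) hconj
  rcases eq_or_ne u 0 with rfl | hu
  · simp only [abs_zero, mul_zero, zero_mul, add_zero]
    rw [Real.zero_rpow (by linarith)]; positivity
  have hu' : 0 < |u| := abs_pos.2 hu
  have e1 : |(|u| ^ (q-2) * u)| ^ (q/(q-1)) = |u| ^ q := by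
    rw [abs_mul, abs_of_nonneg (by positivity : (0:ℝ) ≤ |u| ^ (q-2)), ← Real.rpow_add_one hu'.ne',
      ← Real.rpow_mul hu'.le]
    congr 1
    have : q - 1 ≠ 0 := by linarith
    field_simp; ring
  have e2 : (|u| ^ (q-2) * u) * u = |u| ^ q := by
    have : |u| ^ q = |u| ^ (q-2) * |u| ^ (2:ℝ) := by
      rw [← Real.rpow_add hu']; congr 1; ring
    rw [this, Real.rpow_two, sq_abs]; ring
  rw [e1] at hy
  have hq0 : 0 < q := by linarith
  have h3 : v * (|u| ^ (q-2) * u) * q ≤ |v| ^ q + (q-1) * |u| ^ q := by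
    have := mul_le_mul_of_nonneg_right hy hq0.le
    have e : (|v| ^ q / q + |u| ^ q / (q/(q-1))) * q = |v| ^ q + (q-1) * |u| ^ q := by
      have : q - 1 ≠ 0 := by linarith
      field_simp
    linarith
  linear_combination h3 + (-q) * e2

lemma psi_lip {p u v M : ℝ} (hp : 2 < p) (hu : |u| ≤ M) (hv : |v| ≤ M) :
    |psi p u - psi p v| ≤ (p-1) * M ^ (p-2) * |u - v| := by
  wlog h : v ≤ u generalizing u v
  · rw [abs_sub_comm, abs_sub_comm u]
    exact this hv hu (le_of_not_ge h)
  have hM : 0 ≤ M := (abs_nonneg u).trans hu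
  have hMp : 0 ≤ M ^ (p-2) := by positivity
  rw [abs_of_nonneg (sub_nonneg.2 ((psi_strictMono hp).monotone h)), abs_of_nonneg (sub_nonneg.2 h)]
  have key : ∀ x y : ℝ, 0 ≤ y → y ≤ x → x ≤ M → psi p x - psi p y ≤ (p-1) * M ^ (p-2) * (x - y) := by
    intro x y hy hyx hxM
    have hx := hy.trans hyx
    have := tangent (q := p-1) (by linarith) x y
    rw [psi_nonneg_eq hp hx, psi_nonneg_eq hp hy]
    rw [abs_of_nonneg hx, abs_of_nonneg hy] at this
    have e : x ^ (p - 1 - 2) * x = x ^ (p-2) ∨ x = y := by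
      rcases hx.eq_or_lt with rfl | hx
      · right; linarith
      · left; rw [← Real.rpow_add_one hx.ne']; congr 1; ring
    have h5 : x ^ (p-2) ≤ M ^ (p-2) := Real.rpow_le_rpow hx hxM (by linarith)
    rcases e with e | rfl
    · rw [e] at this
      have : (p-1) * x ^ (p-2) * (x-y) ≤ (p-1) * M ^ (p-2) * (x - y) := by
        have := sub_nonneg.2 hyx
        have : 0 ≤ p-1 := by linarith
        gcongr
      linarith
    · simp
  rcases le_total 0 v with h0 | h0
  · exact key u v h0 h ((le_abs_self u).trans hu)
  rcases le_total 0 u with h1 | h1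
  · have a1 := key u 0 le_rfl h1 ((le_abs_self u).trans hu)
    have a2 := key (-v) 0 le_rfl (by linarith) ((neg_le_abs v).trans hv)
    rw [psi_neg] at a2
    have : psi p 0 = 0 := by simp [psi]
    rw [this] at a1 a2
    linarith
  · have a2 := key (-v) (-u) (by linarith) (by linarith) ((neg_le_abs v).trans hv)
    rw [psi_neg, psi_neg] at a2
    linarith

lemma psi_cut {p U v : ℝ} (hp : 2 < p) (hU : 0 ≤ U) (hv : 0 ≤ v) :
    psi p (U - v) ≤ 2 * U ^ (p-1) - (v/2) ^ (p-1) := by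
  rcases lt_or_ge U (v/2) with h | h
  · have h1 : psi p (U - v) ≤ psi p (-(v/2)) := (psi_strictMono hp).monotone (by linarith)
    rw [psi_neg, psi_nonneg_eq (u := v/2) hp (by linarith)] at h1
    have : 0 ≤ U ^ (p-1) := by positivity
    linarith
  · have h1 : psi p (U - v) ≤ psi p U := (psi_strictMono hp).monotone (by linarith)
    rw [psi_nonneg_eq hp hU] at h1
    have : (v/2) ^ (p-1) ≤ U ^ (p-1) := Real.rpow_le_rpow (by linarith) h (by linarith)
    linarith

lemma ac_of_local (R : ℝ → ℝ) (hR : Monotone R) (k : ℝ → ℝ) (hk0 : ∀ x, 0 ≤ k x)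
    (hk : Integrable k)
    (h : ∀ x, ∃ C : ℝ, ∀ y, |R y - R x| ≤ C * |∫ s in x..y, k s|) :
    ∃ f : ℝ → ℝ, (∀ a b, IntervalIntegrable f volume a b) ∧
      ∀ a b, a ≤ b → R b - R a = ∫ s in a..b, f s := by
  have hcont : Continuous R := by
    rw [continuous_iff_continuousAt]
    intro x
    obtain ⟨C, hC⟩ := h x
    have h1 : Continuous fun y => ∫ s in x..y, k s :=
      intervalIntegral.continuous_primitive (fun a b => hk.intervalIntegrable) x
    have h2 : Filter.Tendsto (fun y => C * |∫ s in x..y, k s|) (nhds x) (nhds 0) := by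
      have := ((h1.abs).const_mul C).tendsto x
      simpa using this
    rw [ContinuousAt, tendsto_iff_dist_tendsto_zero]
    exact squeeze_zero (fun _ => dist_nonneg) (fun y => by rw [Real.dist_eq]; exact hC y) h2
  let S : StieltjesFunction ℝ := ⟨R, hR, fun x => hcont.continuousWithinAt⟩
  have hSR : ∀ x, S x = R x := fun x => rfl
  have hleft : ∀ x, Function.leftLim S x = R x := by
    intro x
    change Function.leftLim R x = R x
    exact leftLim_eq_of_tendsto (hcont.continuousWithinAt (s := Iio x) (x := x))
  set μ := S.measure with hμ
  let ν : Measure ℝ := volume.withDensity (fun x => ENNReal.ofReal (k x))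
  have hνf : IsFiniteMeasure ν := isFiniteMeasure_withDensity_ofReal hk.2
  have hνI : ∀ a b, a ≤ b → ν (Icc a b) = ENNReal.ofReal (∫ s in a..b, k s) := by
    intro a b hab
    rw [withDensity_apply _ measurableSet_Icc, intervalIntegral.integral_of_le hab,
      ← integral_Icc_eq_integral_Ioc, ofReal_integral_eq_lintegral_ofReal hk.integrableOn
        (Filter.Eventually.of_forall hk0)]
  have hac : μ ≪ volume := by
    refine Measure.AbsolutelyContinuous.trans ?_ (withDensity_absolutelyContinuous volume
      (fun x => ENNReal.ofReal (k x)))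
    intro N hN
    have hcov : N ⊆ ⋃ n : ℕ, (N ∩ {x | ∀ y, |R y - R x| ≤ n * |∫ s in x..y, k s|}) := by
      intro x hx
      obtain ⟨C, hC⟩ := h x
      obtain ⟨n, hn⟩ := exists_nat_ge C
      refine mem_iUnion.2 ⟨n, hx, fun y => (hC y).trans ?_⟩
      gcongr
    refine measure_mono_null hcov (measure_iUnion_null fun n => ?_)
    set E := N ∩ {x | ∀ y, |R y - R x| ≤ n * |∫ s in x..y, k s|} with hE
    have hνE : ν E = 0 := measure_mono_null inter_subset_left hN
    have key : μ E ≤ ((n : ℝ≥0∞) • ν) E := by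
      have : IsFiniteMeasure (((n : ℝ≥0) : ℝ≥0∞) • ν) := Measure.smul_finite ν ENNReal.coe_ne_top
      refine (Besicovitch.vitaliFamily μ).measure_le_of_frequently_le (((n : ℝ≥0) : ℝ≥0∞) • ν)
        Measure.AbsolutelyContinuous.rfl E ?_
      intro x hx
      refine (Besicovitch.tendsto_filterAt μ x).frequently (Filter.Eventually.frequently ?_)
      filter_upwards [self_mem_nhdsWithin] with r hr
      have hr : 0 < r := hr
      rw [Real.closedBall_eq_Icc, hμ, S.measure_Icc, hleft, hSR, Measure.smul_apply, smul_eq_mul,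
        hνI _ _ (by linarith)]
      have h1 := hx.2 (x + r)
      have h2 := hx.2 (x - r)
      rw [abs_of_nonneg (sub_nonneg.2 (hR (by linarith))), abs_of_nonneg
        (intervalIntegral.integral_nonneg (by linarith) fun _ _ => hk0 _)] at h1
      rw [abs_sub_comm, abs_of_nonneg (sub_nonneg.2 (hR (by linarith))), intervalIntegral.integral_symm,
        abs_neg, abs_of_nonneg
        (intervalIntegral.integral_nonneg (by linarith) fun _ _ => hk0 _)] at h2
      have h3 := intervalIntegral.integral_add_adjacent_intervals
        (hk.intervalIntegrable (a := x - r) (b := x)) (hk.intervalIntegrable (a := x) (b := x + r))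
      have : ((n : ℝ≥0) : ℝ≥0∞) = ENNReal.ofReal (n : ℝ) := by simp
      rw [this, ← ENNReal.ofReal_mul (by positivity)]
      apply ENNReal.ofReal_le_ofReal
      rw [← h3, mul_add]
      linarith
    rw [Measure.smul_apply, hνE] at key
    simpa using key
  have hdens : volume.withDensity (μ.rnDeriv volume) = μ := Measure.withDensity_rnDeriv_eq _ _ hac
  have hfin : ∀ a b : ℝ, ∫⁻ x in Ioc a b, μ.rnDeriv volume x = ENNReal.ofReal (R b - R a) := by
    intro a b
    rw [← withDensity_apply _ measurableSet_Ioc, hdens, hμ, S.measure_Ioc]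
  have hint : ∀ a b : ℝ, IntegrableOn (fun x => (μ.rnDeriv volume x).toReal) (Ioc a b) := by
    intro a b
    refine integrable_toReal_of_lintegral_ne_top (Measure.measurable_rnDeriv _ _).aemeasurable ?_
    rw [hfin]; exact ENNReal.ofReal_ne_top
  refine ⟨fun x => (μ.rnDeriv volume x).toReal, fun a b => ⟨hint a b, hint b a⟩, ?_⟩
  intro a b hab
  rw [intervalIntegral.integral_of_le hab, integral_toReal (Measure.measurable_rnDeriv _ _).aemeasurable,
    hfin, ENNReal.toReal_ofReal (sub_nonneg.2 (hR hab))]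
  refine ae_lt_top (Measure.measurable_rnDeriv _ _) ?_
  rw [hfin]; exact ENNReal.ofReal_ne_top

lemma absContZero_of_ac {T : ℝ} (hT : 0 < T) {F : ℝ → ℝ}
    (hF : AbsolutelyContinuousOnInterval F 0 T) (h0 : F 0 = 0) : ∃ f : ℝ → ℝ, IntegrableOn f (Set.Ioc 0 T) ∧
    ∀ t ∈ Set.Icc (0:ℝ) T, F t = ∫ s in (0:ℝ)..t, f s := by
  refine ⟨deriv F, ?_, ?_⟩
  · have := hF.intervalIntegrable_deriv
    rwa [intervalIntegrable_iff_integrableOn_Ioc_of_le hT.le] at this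
  · intro t ht
    have : AbsolutelyContinuousOnInterval F 0 t := hF.mono (by
      rw [uIcc_of_le ht.1, uIcc_of_le hT.le]; exact Icc_subset_Icc_right ht.2)
    rw [this.integral_deriv_eq_sub, h0, sub_zero]

lemma ac_exp {T : ℝ} {F : ℝ → ℝ}
    (hF : AbsolutelyContinuousOnInterval F 0 T) :
    AbsolutelyContinuousOnInterval (fun t => Real.exp (F t)) 0 T := by
  obtain ⟨M, hM⟩ := hF.exists_bound
  have hlip : ∀ x ∈ uIcc 0 T, ∀ y ∈ uIcc 0 T,
      dist (Real.exp (F x)) (Real.exp (F y)) ≤ Real.exp M * dist (F x) (F y) := by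
    have key : ∀ u v : ℝ, u ≤ M → v ≤ u → |Real.exp u - Real.exp v| ≤ Real.exp M * |u - v| := by
      intro u v hu hvu
      rw [abs_of_nonneg (sub_nonneg.2 (Real.exp_le_exp.2 hvu)), abs_of_nonneg (sub_nonneg.2 hvu)]
      have h1 := Real.add_one_le_exp (v - u)
      have h2 : Real.exp v = Real.exp u * Real.exp (v - u) := by rw [← Real.exp_add]; congr 1; ring
      have h3 : Real.exp u ≤ Real.exp M := Real.exp_le_exp.2 hu
      have h4 := Real.exp_pos u
      nlinarith [mul_le_mul_of_nonneg_right h3 (sub_nonneg.2 hvu)]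
    intro x hx y hy
    have h1 := (le_abs_self _).trans (hM x hx)
    have h2 := (le_abs_self _).trans (hM y hy)
    rw [Real.dist_eq, Real.dist_eq]
    rcases le_total (F y) (F x) with h | h
    · exact key _ _ h1 h
    · rw [abs_sub_comm, abs_sub_comm (F x)]; exact key _ _ h2 h
  rw [absolutelyContinuousOnInterval_iff] at hF ⊢
  intro ε hε
  obtain ⟨δ, hδ, h⟩ := hF (ε / Real.exp M) (by positivity)
  refine ⟨δ, hδ, fun E hE hlt => ?_⟩
  have := h E hE hlt
  rw [lt_div_iff₀ (Real.exp_pos M), mul_comm, Finset.mul_sum] at this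
  refine lt_of_le_of_lt (Finset.sum_le_sum fun i hi => ?_) this
  have := hE.1 i hi
  exact hlip _ this.1 _ this.2

section rv
variable {Ω : Type*} [MeasurableSpace Ω] {P : Measure Ω} [IsProbabilityMeasure P]

lemma int_rpow {p q : ℝ} (hq : 0 < q) (hqp : q ≤ p) {X : Ω → ℝ}
    (hX : MemLp X (ENNReal.ofReal p) P) : Integrable (fun ω => |X ω| ^ q) P := by
  have h1 : MemLp X (ENNReal.ofReal q) P := hX.mono_exponent (ENNReal.ofReal_le_ofReal hqp)
  have := h1.integrable_norm_rpow (by simpa using hq) ENNReal.ofReal_ne_top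
  simpa [ENNReal.toReal_ofReal hq.le] using this

lemma memLp_csub {p : ℝ} {X : Ω → ℝ} (hX : MemLp X (ENNReal.ofReal p) P) (x : ℝ) :
    MemLp (fun ω => x - X ω) (ENNReal.ofReal p) P := (memLp_const x).sub hX

lemma int_psi {p : ℝ} (hp : 2 < p) {X : Ω → ℝ} (hX : MemLp X (ENNReal.ofReal p) P) (x : ℝ) :
    Integrable (fun ω => psi p (x - X ω)) P := by
  have h := memLp_csub hX x
  have h1 := int_rpow (q := p-1) (by linarith) (by linarith) h
  refine h1.mono ((psi_continuous hp).comp_aestronglyMeasurable h.1) ?_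
  refine Filter.Eventually.of_forall fun ω => ?_
  rw [Real.norm_eq_abs, psi_abs' hp, Real.norm_of_nonneg (by positivity)]

lemma g_strictMono {p : ℝ} (hp : 2 < p) {X : Ω → ℝ} (hX : MemLp X (ENNReal.ofReal p) P) :
    StrictMono (fun x => ∫ ω, psi p (x - X ω) ∂P) := by
  intro x y hxy
  have hpos : ∀ ω, 0 < psi p (y - X ω) - psi p (x - X ω) := fun ω =>
    sub_pos.2 (psi_strictMono hp (by linarith))
  have h : 0 < ∫ ω, (psi p (y - X ω) - psi p (x - X ω)) ∂P := by
    rw [integral_pos_iff_support_of_nonneg (fun ω => (hpos ω).le)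
      ((int_psi hp hX y).sub (int_psi hp hX x))]
    have : (Function.support fun ω => psi p (y - X ω) - psi p (x - X ω)) = univ := by
      ext ω; simpa using (hpos ω).ne'
    rw [this]; simp
  rw [integral_sub (int_psi hp hX y) (int_psi hp hX x)] at h
  simpa using h

lemma g_continuous {p : ℝ} (hp : 2 < p) {X : Ω → ℝ} (hX : MemLp X (ENNReal.ofReal p) P) :
    Continuous (fun x => ∫ ω, psi p (x - X ω) ∂P) := by
  rw [continuous_iff_continuousAt]
  intro x
  have hB : MemLp (fun ω => (|x| + 1) + |X ω|) (ENNReal.ofReal p) P := by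
    have h1 : MemLp (fun ω => |X ω|) (ENNReal.ofReal p) P := hX.norm
    have h2 : MemLp (fun _ : Ω => |x| + 1) (ENNReal.ofReal p) P := memLp_const _
    exact h2.add h1
  refine continuousAt_of_dominated (bound := fun ω => |((|x| + 1) + |X ω|)| ^ (p-1)) ?_ ?_
    (int_rpow (by linarith) (by linarith) hB) ?_
  · exact Filter.Eventually.of_forall fun y => (int_psi hp hX y).1
  · filter_upwards [Metric.ball_mem_nhds x one_pos] with y hy
    refine Filter.Eventually.of_forall fun ω => ?_
    rw [Real.norm_eq_abs, psi_abs' hp]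
    refine Real.rpow_le_rpow (abs_nonneg _) ?_ (by linarith)
    have h1 : |y - x| < 1 := by simpa [Real.dist_eq] using hy
    have h2 : |y - X ω| ≤ |y - x| + |x| + |X ω| := by
      calc |y - X ω| = |(y - x) + x + (- X ω)| := by congr 1; ring
        _ ≤ _ := by
          refine (abs_add_three _ _ _).trans ?_
          rw [abs_neg]
    refine le_trans ?_ (le_abs_self _)
    linarith
  · refine Filter.Eventually.of_forall fun ω => ?_
    exact ((psi_continuous hp).comp (continuous_id.sub continuous_const)).continuousAt

lemma g_root {p : ℝ} (hp : 2 < p) {X : Ω → ℝ} (hX : MemLp X (ENNReal.ofReal p) P)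
    (hX0 : ∀ᵐ ω ∂P, 0 ≤ X ω) : ∃ x, 0 ≤ x ∧ ∫ ω, psi p (x - X ω) ∂P = 0 := by
  have h0 : ∫ ω, psi p (0 - X ω) ∂P ≤ 0 := by
    apply integral_nonpos_of_ae
    filter_upwards [hX0] with ω hω
    rw [zero_sub, psi_neg]
    simpa using psi_nonneg hω
  have hI := int_rpow (q := p-1) (by linarith) (by linarith) hX
  set M := ∫ ω, |X ω| ^ (p-1) ∂P with hM
  have hM0 : 0 ≤ M := integral_nonneg fun ω => by positivity
  obtain ⟨b, hb0, hb⟩ : ∃ b : ℝ, 0 ≤ b ∧ 2 * M ≤ (b/2) ^ (p-1) := by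
    refine ⟨2 * (2*M) ^ (1/(p-1)), by positivity, ?_⟩
    rw [mul_div_cancel_left₀ _ (by norm_num : (2:ℝ) ≠ 0), ← Real.rpow_mul (by positivity),
      one_div_mul_cancel (by linarith), Real.rpow_one]
  have h1 : 0 ≤ ∫ ω, psi p (b - X ω) ∂P := by
    have : ∫ ω, (((b/2) ^ (p-1)) - 2 * |X ω| ^ (p-1)) ∂P ≤ ∫ ω, psi p (b - X ω) ∂P := by
      refine integral_mono_ae ((integrable_const _).sub (hI.const_mul 2)) (int_psi hp hX b) ?_
      filter_upwards [hX0] with ω hω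
      have := psi_cut hp hω hb0
      rw [← neg_sub b, psi_neg] at this
      rw [abs_of_nonneg hω]
      linarith
    rw [integral_sub (integrable_const _) (hI.const_mul 2), integral_const_mul] at this
    simp only [integral_const, probReal_univ, smul_eq_mul, one_mul] at this
    linarith
  obtain ⟨x, hx, hx'⟩ := intermediate_value_Icc hb0 (g_continuous hp hX).continuousOn ⟨h0, h1⟩
  exact ⟨x, hx.1, hx'⟩

lemma min_lt {p : ℝ} (hp : 2 < p) {X : Ω → ℝ} (hX : MemLp X (ENNReal.ofReal p) P) {x y : ℝ}
    (hx : ∫ ω, psi p (x - X ω) ∂P = 0) (hxy : y ≠ x) :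
    ∫ ω, |X ω - x| ^ p ∂P < ∫ ω, |X ω - y| ^ p ∂P := by
  have hI : ∀ x, Integrable (fun ω => |X ω - x| ^ p) P := fun x => by
    have := int_rpow (q := p) (by linarith) le_rfl (memLp_csub hX x)
    simpa only [abs_sub_comm] using this
  have tan : ∀ u v : ℝ, ∫ ω, |X ω - u| ^ p ∂P + p * (v - u) * ∫ ω, psi p (u - X ω) ∂P
      ≤ ∫ ω, |X ω - v| ^ p ∂P := by
    intro u v
    rw [← integral_const_mul, ← integral_add (hI u) ((int_psi hp hX u).const_mul _)]
    refine integral_mono ((hI u).add ((int_psi hp hX u).const_mul _)) (hI v) fun ω => ?_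
    have := tangent (q := p) (by linarith) (u - X ω) (v - X ω)
    simp only [psi]
    rw [abs_sub_comm (X ω), abs_sub_comm (X ω)]
    linarith
  have hw : 0 < ((y - (x+y)/2)) * ∫ ω, psi p ((x+y)/2 - X ω) ∂P := by
    rcases lt_or_gt_of_ne hxy with h | h
    · have := g_strictMono hp hX (show (x+y)/2 < x by linarith)
      simp only [hx] at this
      exact mul_pos_of_neg_of_neg (by linarith) this
    · have := g_strictMono hp hX (show x < (x+y)/2 by linarith)
      simp only [hx] at this
      exact mul_pos (by linarith) this
  have h1 := tan x ((x+y)/2)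
  rw [hx] at h1
  have h2 := tan ((x+y)/2) y
  have : 0 < p * ((y - (x+y)/2) * ∫ ω, psi p ((x+y)/2 - X ω) ∂P) := mul_pos (by linarith) hw
  linarith

lemma root_mono {p : ℝ} (hp : 2 < p) {X Y : Ω → ℝ} (hX : MemLp X (ENNReal.ofReal p) P)
    (hY : MemLp Y (ENNReal.ofReal p) P) (hXY : ∀ᵐ ω ∂P, X ω ≤ Y ω) {x y : ℝ}
    (hx : ∫ ω, psi p (x - X ω) ∂P = 0) (hy : ∫ ω, psi p (y - Y ω) ∂P = 0) : x ≤ y := by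
  refine (g_strictMono hp hY).le_iff_le.1 ?_
  simp only [hy]
  rw [← hx]
  refine integral_mono_ae (int_psi hp hY x) (int_psi hp hX x) ?_
  filter_upwards [hXY] with ω h
  exact (psi_strictMono hp).monotone (by linarith)

/-- nondegenerate comparison -/
lemma root_case1 {p : ℝ} (hp : 2 < p) {X Y W : Ω → ℝ} (hX : MemLp X (ENNReal.ofReal p) P)
    (hY : MemLp Y (ENNReal.ofReal p) P) {x y : ℝ}
    (hWX : ∀ᵐ ω ∂P, |y - X ω| ≤ W ω) (hWY : ∀ᵐ ω ∂P, |y - Y ω| ≤ W ω)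
    (hInt : Integrable (fun ω => W ω ^ (p-2) * |X ω - Y ω|) P)
    (hx : ∫ ω, psi p (x - X ω) ∂P = 0) (hy : ∫ ω, psi p (y - Y ω) ∂P = 0) :
    (∫ ω, |x - X ω| ^ (p-2) ∂P) * |y - x| ≤ 2 * (p-1) * ∫ ω, W ω ^ (p-2) * |X ω - Y ω| ∂P := by
  have hI2 := int_rpow (q := p-2) (by linarith) (by linarith) (memLp_csub hX x)
  have h1 : (∫ ω, |x - X ω| ^ (p-2) ∂P) * |y - x| / 2 ≤ |∫ ω, psi p (y - X ω) ∂P| := by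
    rcases le_total x y with h | h
    · refine le_trans ?_ (le_abs_self _)
      rw [abs_of_nonneg (sub_nonneg.2 h), ← sub_zero (∫ ω, psi p (y - X ω) ∂P), ← hx,
        ← integral_sub (int_psi hp hX y) (int_psi hp hX x), mul_div_assoc, ← integral_mul_const]
      refine integral_mono (hI2.mul_const _) ((int_psi hp hX y).sub (int_psi hp hX x)) fun ω => ?_
      have := psi_lower' (u := y - X ω) (v := x - X ω) hp (by linarith)
      simp only
      linarith
    · refine le_trans ?_ (neg_le_abs _)
      rw [abs_sub_comm, abs_of_nonneg (sub_nonneg.2 h), ← zero_sub (∫ ω, psi p (y - X ω) ∂P), ← hx,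
        ← integral_sub (int_psi hp hX x) (int_psi hp hX y), mul_div_assoc, ← integral_mul_const]
      refine integral_mono (hI2.mul_const _) ((int_psi hp hX x).sub (int_psi hp hX y)) fun ω => ?_
      have := psi_lower (u := x - X ω) (v := y - X ω) hp (by linarith)
      simp only
      linarith
  have h2 : |∫ ω, psi p (y - X ω) ∂P| ≤ (p-1) * ∫ ω, W ω ^ (p-2) * |X ω - Y ω| ∂P := by
    rw [← sub_zero (∫ ω, psi p (y - X ω) ∂P), ← hy,
      ← integral_sub (int_psi hp hX y) (int_psi hp hY y), ← integral_const_mul]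
    refine (abs_integral_le_integral_abs).trans ?_
    refine integral_mono_ae ((int_psi hp hX y).sub (int_psi hp hY y)).abs (hInt.const_mul _) ?_
    filter_upwards [hWX, hWY] with ω a b
    have := psi_lip hp a b
    have e : |y - X ω - (y - Y ω)| = |X ω - Y ω| := by rw [abs_sub_comm]; congr 1; ring
    rw [e] at this
    linarith
  linarith

/-- degenerate comparison -/
lemma root_case2 {p : ℝ} (hp : 2 < p) {X Y : Ω → ℝ} (hX : MemLp X (ENNReal.ofReal p) P)
    (hY : MemLp Y (ENNReal.ofReal p) P) {x y : ℝ}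
    (hXY : (∀ᵐ ω ∂P, X ω ≤ Y ω) ∨ (∀ᵐ ω ∂P, Y ω ≤ X ω))
    (hx : ∫ ω, psi p (x - X ω) ∂P = 0) (hy : ∫ ω, psi p (y - Y ω) ∂P = 0)
    (hdeg : ∫ ω, |x - X ω| ^ (p-2) ∂P = 0) :
    (|y - x| / 2) ^ (p-1) ≤ 2 * ∫ ω, |X ω - Y ω| ^ (p-1) ∂P := by
  have hI2 := int_rpow (q := p-2) (by linarith) (by linarith) (memLp_csub hX x)
  have hXx : ∀ᵐ ω ∂P, X ω = x := by
    have := (integral_eq_zero_iff_of_nonneg (fun ω => by positivity) hI2).1 hdeg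
    filter_upwards [this] with ω hω
    have h3 : |x - X ω| = 0 := by
      by_contra hne
      have := Real.rpow_pos_of_pos (lt_of_le_of_ne (abs_nonneg _) (Ne.symm hne)) (p-2)
      simp only [Pi.zero_apply] at hω
      linarith
    linarith [abs_eq_zero.1 h3]
  have hI := int_rpow (q := p-1) (by linarith) (by linarith) (hX.sub hY)
  simp only [Pi.sub_apply] at hI
  have key : ∀ s : ℝ, (∫ ω, s * psi p (y - Y ω) ∂P = 0) →
      (∀ᵐ ω ∂P, s * psi p (y - Y ω) ≤ 2 * |X ω - Y ω| ^ (p-1) - (|y - x| / 2) ^ (p-1)) →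
      (|y - x| / 2) ^ (p-1) ≤ 2 * ∫ ω, |X ω - Y ω| ^ (p-1) ∂P := by
    intro s h0 h
    have := integral_mono_ae ((int_psi hp hY y).const_mul s)
      ((hI.const_mul 2).sub (integrable_const ((|y - x| / 2) ^ (p-1)))) h
    rw [h0] at this
    simp only [Pi.sub_apply] at this
    rw [integral_sub (hI.const_mul 2) (integrable_const _), integral_const_mul] at this
    simp only [integral_const, probReal_univ, smul_eq_mul, one_mul] at this
    linarith
  rcases hXY with h | h
  · have hxy := root_mono hp hX hY h hx hy
    refine key (-1) (by rw [integral_const_mul, hy, mul_zero]) ?_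
    filter_upwards [h, hXx] with ω h1 h2
    have := psi_cut (U := Y ω - X ω) (v := y - x) hp (by linarith) (by linarith)
    rw [abs_sub_comm, abs_of_nonneg (by linarith : 0 ≤ Y ω - X ω), abs_of_nonneg (by linarith : 0 ≤ y - x)]
    have e : Y ω - X ω - (y - x) = - (y - Y ω) := by rw [h2]; ring
    rw [e, psi_neg] at this
    linarith
  · have hxy := root_mono hp hY hX h hy hx
    refine key 1 (by rw [integral_const_mul, hy, mul_zero]) ?_
    filter_upwards [h, hXx] with ω h1 h2
    have := psi_cut (U := X ω - Y ω) (v := x - y) hp (by linarith) (by linarith)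
    rw [abs_of_nonneg (by linarith : 0 ≤ X ω - Y ω), abs_sub_comm y, abs_of_nonneg (by linarith : 0 ≤ x - y)]
    have e : X ω - Y ω - (x - y) = (y - Y ω) := by rw [h2]; ring
    rw [e] at this
    linarith

end rv

lemma jensen_aux {α : Type*} [MeasurableSpace α] (μ : Measure α) {q : ℝ} (hq : 1 < q)
    {h : α → ℝ≥0∞} (hh : AEMeasurable h μ) :
    (∫⁻ r, h r ∂μ) ^ q ≤ (∫⁻ r, h r ^ q ∂μ) * μ univ ^ (q-1) := by
  have hconj : q.HolderConjugate (q / (q-1)) := Real.HolderConjugate.conjExponent hq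
  have := ENNReal.lintegral_mul_le_Lp_mul_Lq μ hconj hh (g := fun _ => 1) aemeasurable_const
  simp only [Pi.mul_apply, mul_one, ENNReal.one_rpow, lintegral_const, one_mul] at this
  have h2 := ENNReal.rpow_le_rpow this (by linarith : 0 ≤ q)
  rw [ENNReal.mul_rpow_of_nonneg _ _ (by linarith), ← ENNReal.rpow_mul, ← ENNReal.rpow_mul] at h2
  have e1 : 1 / q * q = 1 := one_div_mul_cancel (by linarith)
  have e2 : 1 / (q / (q-1)) * q = q - 1 := by
    have : q - 1 ≠ 0 := by linarith
    field_simp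
  rwa [e1, e2, ENNReal.rpow_one] at h2

lemma mink {Ω : Type*} [MeasurableSpace Ω] {P : Measure Ω} [IsProbabilityMeasure P]
    {q : ℝ} (hq : 1 < q) (S : Set ℝ) (hS : MeasurableSet S) (f : ℝ → Ω → ℝ≥0∞)
    (hf : Measurable (Function.uncurry f)) (w : ℝ → ℝ≥0∞) (hw : Measurable w)
    (hw1 : ∀ r, 1 ≤ w r) (hwt : ∀ r ∈ S, w r ≠ ∞)
    (hfw : ∀ r ∈ S, ∫⁻ ω, f r ω ^ q ∂P ≤ w r) :
    ∫⁻ ω, (∫⁻ r in S, f r ω) ^ q ∂P ≤ (∫⁻ r in S, w r) ^ q := by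
  set M := ∫⁻ r in S, w r with hM
  have hw0 : ∀ r, w r ≠ 0 := fun r => (zero_lt_one.trans_le (hw1 r)).ne'
  have hfr : ∀ ω, Measurable (fun r => f r ω) := fun ω => hf.comp measurable_prodMk_right
  have hfo : ∀ r, Measurable (fun ω => f r ω) := fun r => hf.comp measurable_prodMk_left
  have step : ∀ ω, (∫⁻ r in S, f r ω) ^ q ≤
      (∫⁻ r in S, w r * (f r ω / w r) ^ q) * M ^ (q-1) := by
    intro ω
    have h := jensen_aux ((volume.restrict S).withDensity w) hq
      (h := fun r => f r ω / w r) ((hfr ω).div hw).aemeasurable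
    have hd : Measurable (fun r => f r ω / w r) := (hfr ω).div hw
    rw [lintegral_withDensity_eq_lintegral_mul _ hw hd,
      lintegral_withDensity_eq_lintegral_mul _ hw (hd.pow_const q),
      withDensity_apply _ MeasurableSet.univ, Measure.restrict_univ] at h
    refine le_trans (le_of_eq ?_) h
    congr 1
    refine setLIntegral_congr_fun hS fun r hr => ?_
    simp only [Pi.mul_apply]
    rw [ENNReal.mul_div_cancel (hw0 r) (hwt r hr)]
  calc ∫⁻ ω, (∫⁻ r in S, f r ω) ^ q ∂P
      ≤ ∫⁻ ω, (∫⁻ r in S, w r * (f r ω / w r) ^ q) * M ^ (q-1) ∂P := lintegral_mono step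
    _ = (∫⁻ ω, (∫⁻ r in S, w r * (f r ω / w r) ^ q) ∂P) * M ^ (q-1) := by
        refine lintegral_mul_const _ ?_
        refine Measurable.lintegral_prod_left' (f := fun z : ℝ × Ω => w z.1 * (f z.1 z.2 / w z.1) ^ q) ?_
        exact (hw.comp measurable_fst).mul ((hf.div (hw.comp measurable_fst)).pow_const q)
    _ = (∫⁻ r in S, ∫⁻ ω, w r * (f r ω / w r) ^ q ∂P) * M ^ (q-1) := by
        rw [lintegral_lintegral_swap]
        refine Measurable.aemeasurable ?_
        exact ((hw.comp measurable_snd).mul (((hf.comp measurable_swap).div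
          (hw.comp measurable_snd)).pow_const q))
    _ ≤ M * M ^ (q-1) := by
        gcongr
        rw [hM]
        refine setLIntegral_mono hw fun r hr => ?_
        have : ∀ ω, w r * (f r ω / w r) ^ q = (w r * (w r)⁻¹ ^ q) * f r ω ^ q := by
          intro ω
          rw [div_eq_mul_inv, ENNReal.mul_rpow_of_nonneg _ _ (by linarith)]; ring
        simp_rw [this]
        rw [lintegral_const_mul _ ((hfo r).pow_const q)]
        have h1 : w r * (w r)⁻¹ ^ q ≤ 1 := by
          calc w r * (w r)⁻¹ ^ q ≤ w r * (w r)⁻¹ := by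
                gcongr
                exact ENNReal.rpow_le_self_of_le_one (ENNReal.inv_le_one.2 (hw1 r)) hq.le
            _ = 1 := ENNReal.mul_inv_cancel (hw0 r) (hwt r hr)
        calc _ ≤ 1 * w r := mul_le_mul' h1 (hfw r hr)
          _ = w r := one_mul _
    _ = M ^ q := by
        nth_rewrite 1 [← ENNReal.rpow_one M]
        rw [← ENNReal.rpow_add_of_nonneg _ _ (by norm_num) (by linarith)]
        congr 1; ring

structure Good {Ω : Type*} [MeasurableSpace Ω] (P : Measure Ω) (T p : ℝ) (y : ℝ → Ω → ℝ) : Prop where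
  meas : Measurable (Function.uncurry y)
  nn : ∀ r ω, 0 ≤ y r ω
  supp : ∀ r, r ∉ Ioc 0 T → ∀ ω, y r ω = 0
  intp : ∀ r, Integrable (fun ω => y r ω ^ p) P
  intr : Integrable (fun r => ∫ ω, y r ω ^ p ∂P)

def YY {Ω : Type*} (y : ℝ → Ω → ℝ) (t : ℝ) (ω : Ω) : ℝ := ∫ s, (Iic t).indicator (fun s => y s ω) s
def BB {Ω : Type*} (y : ℝ → Ω → ℝ) (ω : Ω) : ℝ := ∫ s, y s ω
def WW {Ω : Type*} [MeasurableSpace Ω] (P : Measure Ω) (T p : ℝ) (y : ℝ → Ω → ℝ) (r : ℝ) : ℝ :=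
  (Ioc 0 T).indicator (fun r => 1 + ∫ ω, y r ω ^ p ∂P) r

namespace Good
variable {Ω : Type*} [MeasurableSpace Ω] {P : Measure Ω} [IsProbabilityMeasure P] {T p : ℝ}
  {y : ℝ → Ω → ℝ}

lemma measr (h : Good P T p y) (ω : Ω) : Measurable (fun r => y r ω) := h.meas.comp measurable_prodMk_right
lemma meas_o (h : Good P T p y) (r : ℝ) : Measurable (fun ω => y r ω) := h.meas.comp measurable_prodMk_left

lemma WW_nonneg (h : Good P T p y) (r : ℝ) : 0 ≤ WW P T p y r := by
  refine indicator_nonneg (fun r _ => ?_) r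
  have : 0 ≤ ∫ ω, y r ω ^ p ∂P := integral_nonneg fun ω => Real.rpow_nonneg (h.nn _ _) _
  linarith

lemma WW_int (h : Good P T p y) : Integrable (WW P T p y) := by
  have : IntegrableOn (fun r => 1 + ∫ ω, y r ω ^ p ∂P) (Ioc 0 T) :=
    (integrableOn_const (by simp)).add h.intr.integrableOn
  exact this.integrable_indicator measurableSet_Ioc

lemma BB_meas (h : Good P T p y) : Measurable (BB y) := by
  have : StronglyMeasurable (fun ω => ∫ s, (Function.uncurry y) (s, ω)) :=
    StronglyMeasurable.integral_prod_left h.meas.stronglyMeasurable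
  exact this.measurable

lemma YY_meas (h : Good P T p y) : Measurable (Function.uncurry (YY y)) := by
  have h1 : Measurable (fun z : (ℝ × Ω) × ℝ => if z.2 ≤ z.1.1 then y z.2 z.1.2 else 0) := by
    refine Measurable.ite (measurableSet_le measurable_snd (measurable_fst.comp measurable_fst)) ?_
      measurable_const
    exact h.meas.comp (measurable_snd.prodMk (measurable_snd.comp measurable_fst))
  have h2 := h1.stronglyMeasurable.integral_prod_right' (ν := (volume : Measure ℝ))
  have h3 : Function.uncurry (YY y) = fun x : ℝ × Ω => ∫ s : ℝ, if s ≤ x.1 then y s x.2 else 0 := by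
    ext ⟨t, ω⟩
    simp only [Function.uncurry, YY, indicator, mem_Iic]
  rw [h3]
  exact h2.measurable

lemma lint_bound (h : Good P T p y) (hp : 2 < p) {q : ℝ} (hq : 1 < q) (hqp : q ≤ p) {s t : ℝ} (hst : s ≤ t) :
    ∫⁻ ω, (∫⁻ r in Ioc s t, ENNReal.ofReal (y r ω)) ^ q ∂P ≤
      ENNReal.ofReal (∫ r in s..t, WW P T p y r) ^ q := by
  have hW : ∀ r, ∫⁻ ω, ENNReal.ofReal (y r ω) ^ p ∂P = ENNReal.ofReal (∫ ω, y r ω ^ p ∂P) := by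
    intro r
    rw [ofReal_integral_eq_lintegral_ofReal (h.intp r)
      (Filter.Eventually.of_forall fun ω => Real.rpow_nonneg (h.nn _ _) _)]
    refine lintegral_congr fun ω => ?_
    rw [ENNReal.ofReal_rpow_of_nonneg (h.nn _ _) (by linarith)]
  let f : ℝ → Ω → ℝ≥0∞ := fun r ω => ENNReal.ofReal (y r ω)
  have hf : Measurable (Function.uncurry f) := ENNReal.measurable_ofReal.comp h.meas
  let w : ℝ → ℝ≥0∞ := fun r => 1 + ∫⁻ ω, f r ω ^ p ∂P
  have hw : Measurable w := by
    have h1 : Measurable (fun r => ∫⁻ ω, f r ω ^ p ∂P) :=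
      Measurable.lintegral_prod_right' (f := fun z : ℝ × Ω => f z.1 z.2 ^ p) (hf.pow_const p)
    exact h1.const_add 1
  have hww : ∀ r, w r = ENNReal.ofReal (1 + ∫ ω, y r ω ^ p ∂P) := by
    intro r
    have : 0 ≤ ∫ ω, y r ω ^ p ∂P := integral_nonneg fun ω => Real.rpow_nonneg (h.nn _ _) _
    rw [ENNReal.ofReal_add zero_le_one this, ← hW]; simp [w, f]
  have := mink (P := P) hq (Ioc s t ∩ Ioc 0 T) (measurableSet_Ioc.inter measurableSet_Ioc) f hf w hw
    (fun r => by simp [w]) (fun r _ => by rw [hww]; exact ENNReal.ofReal_ne_top) (by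
      intro r _
      have : (1 : ℝ≥0∞) = ∫⁻ ω, 1 ∂P := by simp
      simp only [w]
      rw [this, ← lintegral_add_left measurable_const]
      refine lintegral_mono fun ω => ?_
      rcases le_total (f r ω) 1 with h1 | h1
      · exact (ENNReal.rpow_le_one h1 (by linarith)).trans le_self_add
      · exact (ENNReal.rpow_le_rpow_of_exponent_le h1 hqp).trans le_add_self)
  refine le_trans (le_of_eq ?_) (this.trans (le_of_eq ?_))
  · refine lintegral_congr fun ω => ?_
    congr 1
    rw [inter_comm, ← Measure.restrict_restrict measurableSet_Ioc]
    refine Eq.trans ?_ (lintegral_indicator measurableSet_Ioc _)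
    refine lintegral_congr fun r => ?_
    by_cases hr : r ∈ Ioc 0 T
    · simp [hr, f]
    · simp [hr, h.supp r hr]
  · congr 1
    rw [intervalIntegral.integral_of_le hst, ofReal_integral_eq_lintegral_ofReal
      h.WW_int.integrableOn (Filter.Eventually.of_forall h.WW_nonneg),
      inter_comm, ← Measure.restrict_restrict measurableSet_Ioc, ← lintegral_indicator measurableSet_Ioc]
    refine lintegral_congr fun r => ?_
    by_cases hr : r ∈ Ioc 0 T
    · simp [hr, hww, WW]
    · simp [hr, WW]

lemma L_eq (h : Good P T p y) (hT : 0 < T) (ω : Ω) : ∫⁻ r, ENNReal.ofReal (y r ω) = ∫⁻ r in Ioc 0 T, ENNReal.ofReal (y r ω) := by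
  rw [← lintegral_indicator measurableSet_Ioc]
  refine lintegral_congr fun r => ?_
  by_cases hr : r ∈ Ioc 0 T
  · simp [hr]
  · simp [hr, h.supp r hr]

lemma L_fin (h : Good P T p y) (hp : 2 < p) (hT : 0 < T) :
    ∫⁻ ω, (∫⁻ r, ENNReal.ofReal (y r ω)) ^ p ∂P < ∞ := by
  simp_rw [h.L_eq hT]
  refine (h.lint_bound hp (q := p) (by linarith) le_rfl hT.le).trans_lt ?_
  exact ENNReal.rpow_lt_top_of_nonneg (by linarith) ENNReal.ofReal_ne_top

lemma paths (h : Good P T p y) (hp : 2 < p) (hT : 0 < T) :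
    ∀ᵐ ω ∂P, Integrable (fun r => y r ω) := by
  have hm : Measurable (fun ω => (∫⁻ r, ENNReal.ofReal (y r ω)) ^ p) := by
    refine Measurable.pow_const ?_ _
    exact Measurable.lintegral_prod_left' (f := fun z : ℝ × Ω => ENNReal.ofReal (y z.1 z.2))
      (ENNReal.measurable_ofReal.comp h.meas)
  filter_upwards [ae_lt_top hm (h.L_fin hp hT).ne] with ω hω
  refine ⟨(h.measr ω).aestronglyMeasurable, ?_⟩
  rw [hasFiniteIntegral_iff_ofReal (Filter.Eventually.of_forall fun r => h.nn r ω)]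
  by_contra hc
  rw [not_lt, top_le_iff] at hc
  rw [hc, ENNReal.top_rpow_of_pos (by linarith)] at hω
  exact lt_irrefl _ hω

lemma BB_nonneg (h : Good P T p y) (ω : Ω) : 0 ≤ BB y ω := integral_nonneg fun r => h.nn r ω

lemma BB_memLp (h : Good P T p y) (hp : 2 < p) (hT : 0 < T) : MemLp (BB y) (ENNReal.ofReal p) P := by
  refine ⟨h.BB_meas.aestronglyMeasurable, ?_⟩
  rw [eLpNorm_lt_top_iff_lintegral_rpow_enorm_lt_top (by simp; linarith) ENNReal.ofReal_ne_top,
    ENNReal.toReal_ofReal (by linarith)]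
  refine lt_of_le_of_lt (lintegral_mono fun ω => ?_) (h.L_fin hp hT)
  refine ENNReal.rpow_le_rpow ?_ (by linarith)
  rw [Real.enorm_of_nonneg (h.BB_nonneg ω), BB, integral_eq_lintegral_of_nonneg_ae
    (Filter.Eventually.of_forall fun r => h.nn r ω) (h.measr ω).aestronglyMeasurable]
  exact ENNReal.ofReal_toReal_le

lemma YY_eq (t : ℝ) (ω : Ω) : YY y t ω = ∫ s in Iic t, y s ω := by
  rw [YY, integral_indicator measurableSet_Iic]

lemma YY_nonneg (h : Good P T p y) (t : ℝ) (ω : Ω) : 0 ≤ YY y t ω :=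
  integral_nonneg fun r => indicator_nonneg (fun r _ => h.nn r ω) r

lemma YY_le (h : Good P T p y) {ω : Ω} (hω : Integrable (fun r => y r ω)) (t : ℝ) : YY y t ω ≤ BB y ω := by
  rw [YY_eq]
  exact setIntegral_le_integral hω (Filter.Eventually.of_forall fun r => h.nn r ω)

lemma YY_sub {ω : Ω} (hω : Integrable (fun r => y r ω)) {s t : ℝ} (hst : s ≤ t) :
    YY y t ω - YY y s ω = ∫ r in Ioc s t, y r ω := by
  rw [YY_eq, YY_eq, ← intervalIntegral.integral_of_le hst,
    intervalIntegral.integral_Iic_sub_Iic hω.integrableOn hω.integrableOn]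

lemma YY_mono (h : Good P T p y) {ω : Ω} (hω : Integrable (fun r => y r ω)) {s t : ℝ} (hst : s ≤ t) :
    YY y s ω ≤ YY y t ω := by
  have := YY_sub hω hst
  have : 0 ≤ ∫ r in Ioc s t, y r ω := integral_nonneg fun r => h.nn r ω
  linarith

lemma YY_meas_o (h : Good P T p y) (t : ℝ) : Measurable (YY y t) := h.YY_meas.comp measurable_prodMk_left

lemma YY_memLp (h : Good P T p y) (hp : 2 < p) (hT : 0 < T) (t : ℝ) :
    MemLp (YY y t) (ENNReal.ofReal p) P := by
  refine (h.BB_memLp hp hT).mono (h.YY_meas_o t).aestronglyMeasurable ?_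
  filter_upwards [h.paths hp hT] with ω hω
  rw [Real.norm_of_nonneg (h.YY_nonneg t ω), Real.norm_of_nonneg (h.BB_nonneg ω)]
  exact h.YY_le hω t

lemma YY_zero (h : Good P T p y) (ω : Ω) : YY y 0 ω = 0 := by
  rw [YY_eq]
  refine setIntegral_eq_zero_of_forall_eq_zero fun r hr => h.supp r (fun h' => ?_) ω
  exact absurd h'.1 (not_lt.2 hr)

lemma Hw (h : Good P T p y) (hp : 2 < p) (hT : 0 < T) (s t : ℝ) :
    ∫ ω, |YY y t ω - YY y s ω| ^ (p-1) ∂P ≤ |∫ r in t..s, WW P T p y r| ^ (p-1) := by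
  wlog hst : s ≤ t generalizing s t
  · have := this t s (le_of_not_ge hst)
    rw [intervalIntegral.integral_symm, abs_neg]
    simpa only [abs_sub_comm] using this
  have h1 := h.lint_bound hp (q := p-1) (by linarith) (by linarith) hst
  rw [intervalIntegral.integral_symm, abs_neg,
    abs_of_nonneg (intervalIntegral.integral_nonneg hst fun r _ => h.WW_nonneg r)]
  have hI0 : 0 ≤ ∫ r in s..t, WW P T p y r := intervalIntegral.integral_nonneg hst fun r _ => h.WW_nonneg r
  rw [integral_eq_lintegral_of_nonneg_ae (Filter.Eventually.of_forall fun ω => by positivity)]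
  swap
  · have := ((h.YY_meas_o t).sub (h.YY_meas_o s)).abs.pow_const (p-1)
    exact this.aestronglyMeasurable
  refine ENNReal.toReal_le_of_le_ofReal (by positivity) ?_
  rw [← ENNReal.ofReal_rpow_of_nonneg hI0 (by linarith)]
  refine le_trans (lintegral_mono_ae ?_) h1
  filter_upwards [h.paths hp hT] with ω hω
  rw [YY_sub hω hst, ← ENNReal.ofReal_rpow_of_nonneg (abs_nonneg _) (by linarith)]
  refine ENNReal.rpow_le_rpow ?_ (by linarith)
  rw [abs_of_nonneg (integral_nonneg fun r => h.nn r ω), ofReal_integral_eq_lintegral_ofReal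
    hω.integrableOn (Filter.Eventually.of_forall fun r => h.nn r ω)]

end Good

lemma abs_int_mono {f g : ℝ → ℝ} (hf : ∀ r, 0 ≤ f r) (hfg : ∀ r, f r ≤ g r) (hfi : Integrable f)
    (hgi : Integrable g) (s t : ℝ) : |∫ r in s..t, f r| ≤ |∫ r in s..t, g r| := by
  rw [intervalIntegral.abs_integral_eq_abs_integral_uIoc, intervalIntegral.abs_integral_eq_abs_integral_uIoc]
  have h1 : 0 ≤ ∫ r in uIoc s t, f r := integral_nonneg hf
  have h2 : ∫ r in uIoc s t, f r ≤ ∫ r in uIoc s t, g r :=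
    integral_mono hfi.integrableOn hgi.integrableOn hfg
  rw [abs_of_nonneg h1, abs_of_nonneg (h1.trans h2)]
  exact h2

def KK {Ω : Type*} [MeasurableSpace Ω] (P : Measure Ω) (p ρ : ℝ) (y : ℝ → Ω → ℝ) (r : ℝ) : ℝ :=
  ∫ ω, (ρ + BB y ω) ^ (p-2) * y r ω ∂P

namespace Good
variable {Ω : Type*} [MeasurableSpace Ω] {P : Measure Ω} [IsProbabilityMeasure P] {T p : ℝ}
  {y : ℝ → Ω → ℝ}

lemma W_dom (h : Good P T p y) (hp : 2 < p) (hT : 0 < T) {ρ : ℝ} (hρ : 0 ≤ ρ) :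
    Integrable (fun ω => (ρ + BB y ω) ^ (p-2) * (ρ + BB y ω)) P := by
  have h1 : MemLp (fun ω => ρ + BB y ω) (ENNReal.ofReal p) P := (memLp_const ρ).add (h.BB_memLp hp hT)
  have h2 := int_rpow (q := p-1) (by linarith) (by linarith) h1
  refine h2.congr (Filter.Eventually.of_forall fun ω => ?_)
  have := h.BB_nonneg ω
  simp only
  rw [abs_of_nonneg (by linarith), rpow_split hp (by linarith)]

lemma prod_int (h : Good P T p y) (hp : 2 < p) (hT : 0 < T) {ρ : ℝ} (hρ : 0 ≤ ρ) :
    Integrable (fun x : Ω × ℝ => (ρ + BB y x.1) ^ (p-2) * y x.2 x.1) (P.prod volume) := by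
  have hm : Measurable (fun x : Ω × ℝ => (ρ + BB y x.1) ^ (p-2) * y x.2 x.1) := by
    refine Measurable.mul ?_ (h.meas.comp measurable_swap)
    exact ((h.BB_meas.comp measurable_fst).const_add ρ).pow_const _
  rw [integrable_prod_iff hm.aestronglyMeasurable]
  constructor
  · filter_upwards [h.paths hp hT] with ω hω
    exact hω.const_mul _
  · have : ∀ ω, ∫ r, ‖(ρ + BB y ω) ^ (p-2) * y r ω‖ = (ρ + BB y ω) ^ (p-2) * BB y ω := by
      intro ω
      rw [BB, ← integral_const_mul]
      refine integral_congr_ae (Filter.Eventually.of_forall fun r => ?_)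
      have := h.BB_nonneg ω
      exact Real.norm_of_nonneg (mul_nonneg (Real.rpow_nonneg (add_nonneg hρ this) _) (h.nn r ω))
    simp only [this]
    refine (h.W_dom hp hT hρ).mono ?_ ?_
    · exact (((h.BB_meas.const_add ρ).pow_const _).mul h.BB_meas).aestronglyMeasurable
    · refine Filter.Eventually.of_forall fun ω => ?_
      have := h.BB_nonneg ω
      have h3 : 0 ≤ (ρ + BB y ω) ^ (p-2) := Real.rpow_nonneg (add_nonneg hρ this) _
      rw [Real.norm_of_nonneg (by positivity), Real.norm_of_nonneg (by positivity)]
      exact mul_le_mul_of_nonneg_left (by linarith) h3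

lemma KK_nonneg (h : Good P T p y) {ρ : ℝ} (hρ : 0 ≤ ρ) (r : ℝ) : 0 ≤ KK P p ρ y r :=
  integral_nonneg fun ω => mul_nonneg (Real.rpow_nonneg (add_nonneg hρ (h.BB_nonneg ω)) _) (h.nn r ω)

lemma KK_int (h : Good P T p y) (hp : 2 < p) (hT : 0 < T) {ρ : ℝ} (hρ : 0 ≤ ρ) :
    Integrable (KK P p ρ y) := (h.prod_int hp hT hρ).integral_prod_right

lemma KK_eq (h : Good P T p y) (hp : 2 < p) (hT : 0 < T) {ρ : ℝ} (hρ : 0 ≤ ρ) (s t : ℝ) :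
    Integrable (fun ω => (ρ + BB y ω) ^ (p-2) * |YY y t ω - YY y s ω|) P ∧
    ∫ ω, (ρ + BB y ω) ^ (p-2) * |YY y t ω - YY y s ω| ∂P = |∫ r in t..s, KK P p ρ y r| := by
  wlog hst : s ≤ t generalizing s t
  · have := this t s (le_of_not_ge hst)
    rw [intervalIntegral.integral_symm, abs_neg]
    simpa only [abs_sub_comm] using this
  have hI : Integrable (fun x : Ω × ℝ => (ρ + BB y x.1) ^ (p-2) * y x.2 x.1)
      (P.prod (volume.restrict (Ioc s t))) := by
    refine (h.prod_int hp hT hρ).mono_measure ?_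
    have : P.prod (volume.restrict (Ioc s t)) = (P.prod volume).restrict (univ ×ˢ Ioc s t) := by
      rw [← Measure.prod_restrict, Measure.restrict_univ]
    rw [this]; exact Measure.restrict_le_self
  have he : (fun ω => (ρ + BB y ω) ^ (p-2) * |YY y t ω - YY y s ω|) =ᵐ[P]
      fun ω => ∫ r in Ioc s t, (ρ + BB y ω) ^ (p-2) * y r ω := by
    filter_upwards [h.paths hp hT] with ω hω
    rw [YY_sub hω hst, abs_of_nonneg (integral_nonneg fun r => h.nn r ω), integral_const_mul]
  refine ⟨hI.integral_prod_left.congr he.symm, ?_⟩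
  rw [integral_congr_ae he, intervalIntegral.integral_symm, abs_neg,
    abs_of_nonneg (intervalIntegral.integral_nonneg hst fun r _ => h.KK_nonneg hρ r),
    intervalIntegral.integral_of_le hst]
  exact integral_integral_swap hI

lemma exists_R (h : Good P T p y) (hp : 2 < p) (hT : 0 < T) :
    ∃ R : ℝ → ℝ, AbsolutelyContinuousOnInterval R 0 T ∧ R 0 = 0 ∧
      ∀ t, 0 ≤ t → ∫ ω, psi p (R t - YY y t ω) ∂P = 0 := by
  have hr := fun t => g_root hp (h.YY_memLp hp hT t) (Filter.Eventually.of_forall (h.YY_nonneg t))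
  choose R hR0 hR using hr
  obtain ⟨ρ, hρ, hρr⟩ := g_root hp (h.BB_memLp hp hT) (Filter.Eventually.of_forall h.BB_nonneg)
  have hmono : Monotone R := fun s t hst =>
    root_mono hp (h.YY_memLp hp hT s) (h.YY_memLp hp hT t)
      ((h.paths hp hT).mono fun ω hω => h.YY_mono hω hst) (hR s) (hR t)
  have hRρ : ∀ t, R t ≤ ρ := fun t =>
    root_mono hp (h.YY_memLp hp hT t) (h.BB_memLp hp hT)
      ((h.paths hp hT).mono fun ω hω => h.YY_le hω t) (hR t) hρr
  have hbd : ∀ s t, ∀ᵐ ω ∂P, |R s - YY y t ω| ≤ ρ + BB y ω := by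
    intro s t
    filter_upwards [h.paths hp hT] with ω hω
    have h1 := h.YY_le hω t
    have h2 := h.YY_nonneg t ω
    have h3 := hR0 s
    have h4 := hRρ s
    rw [abs_le]; constructor <;> linarith
  set k : ℝ → ℝ := fun r => KK P p ρ y r + WW P T p y r with hk
  have hk0 : ∀ r, 0 ≤ k r := fun r => add_nonneg (h.KK_nonneg hρ r) (h.WW_nonneg r)
  have hkint : Integrable k := (h.KK_int hp hT hρ).add h.WW_int
  have hKk : ∀ t s, |∫ r in t..s, KK P p ρ y r| ≤ |∫ r in t..s, k r| := by
    intro t s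
    exact abs_int_mono (fun r => h.KK_nonneg hρ r) (fun r => le_add_of_nonneg_right (h.WW_nonneg r))
      (h.KK_int hp hT hρ) hkint t s
  have hWk : ∀ t s, |∫ r in t..s, WW P T p y r| ≤ |∫ r in t..s, k r| := by
    intro t s
    exact abs_int_mono (fun r => h.WW_nonneg r) (fun r => le_add_of_nonneg_left (h.KK_nonneg hρ r))
      h.WW_int hkint t s
  have hloc : ∀ t, ∃ C : ℝ, ∀ s, |R s - R t| ≤ C * |∫ r in t..s, k r| := by
    intro t
    rcases (integral_nonneg (μ := P) (f := fun ω => |R t - YY y t ω| ^ (p-2))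
      fun ω => by positivity).eq_or_lt with h0 | h0
    · refine ⟨4, fun s => ?_⟩
      have h1 := root_case2 hp (h.YY_memLp hp hT t) (h.YY_memLp hp hT s)
        ((le_total t s).imp (fun hts => (h.paths hp hT).mono fun ω hω => h.YY_mono hω hts)
          (fun hts => (h.paths hp hT).mono fun ω hω => h.YY_mono hω hts)) (hR t) (hR s) h0.symm
      have h2 := h.Hw hp hT s t
      have h3 : (|R s - R t| / 2) ^ (p-1) ≤ (2 * |∫ r in t..s, WW P T p y r|) ^ (p-1) := by
        rw [Real.mul_rpow (by norm_num) (abs_nonneg _)]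
        have h4 : (2:ℝ) ≤ 2 ^ (p-1) := by
          conv_lhs => rw [← Real.rpow_one 2]
          exact Real.rpow_le_rpow_of_exponent_le (by norm_num) (by linarith)
        have h5 : 0 ≤ |∫ r in t..s, WW P T p y r| ^ (p-1) := by positivity
        nlinarith [mul_le_mul_of_nonneg_right h4 h5]
      have h4 := (Real.rpow_le_rpow_iff (by positivity) (by positivity) (by linarith)).1 h3
      have := hWk t s
      linarith
    · refine ⟨2 * (p-1) / (∫ ω, |R t - YY y t ω| ^ (p-2) ∂P), fun s => ?_⟩
      have hK := h.KK_eq hp hT hρ s t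
      have h1 := root_case1 hp (h.YY_memLp hp hT t) (h.YY_memLp hp hT s)
        (W := fun ω => ρ + BB y ω) (hbd s t) (hbd s s) hK.1 (hR t) (hR s)
      rw [hK.2] at h1
      have h2 := hKk t s
      rw [div_mul_eq_mul_div, le_div_iff₀ h0]
      have h3 := mul_le_mul_of_nonneg_left h2 (by linarith : 0 ≤ 2 * (p-1))
      linarith
  obtain ⟨f, hf, hRf⟩ := ac_of_local R hmono k hk0 hkint hloc
  have hRz : R 0 = 0 := by
    have := hR 0
    simp only [h.YY_zero, sub_zero, integral_const, probReal_univ, one_smul] at this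
    exact (psi_strictMono hp).injective (this.trans (by simp [psi]))
  refine ⟨fun t => ∫ s in (0:ℝ)..t, f s, ?_, by simp, fun t ht => ?_⟩
  · exact (hf 0 T).absolutelyContinuousOnInterval_intervalIntegral (by simp)
  · simp only
    rw [← hRf 0 t ht, hRz, sub_zero]; exact hR t

end Good

lemma acz_cont {T : ℝ} (hT : 0 < T) {F : ℝ → ℝ} (h : AbsContZero T F) : ContinuousOn F (Icc 0 T) := by
  obtain ⟨f, hf, hF⟩ := h
  have h1 : ContinuousOn (fun t => ∫ s in (0:ℝ)..t, f s) (Icc 0 T) := by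
    have h2 : IntegrableOn f (uIcc 0 T) := by
      rw [uIcc_of_le hT.le]
      exact (integrableOn_Icc_iff_integrableOn_Ioc (μ := volume)).2 hf
    have h3 := intervalIntegral.continuousOn_primitive_interval h2
    rwa [uIcc_of_le hT.le] at h3
  exact h1.congr hF

section cost
variable {Ω : Type*} [MeasurableSpace Ω] {P : Measure Ω} [IsProbabilityMeasure P]

lemma phi_eq {p : ℝ} (hp : 2 < p) {X : Ω → ℝ} (hX : MemLp X (ENNReal.ofReal p) P) (x : ℝ) :
    ∫⁻ ω, ENNReal.ofReal (|X ω - x| ^ p) ∂P = ENNReal.ofReal (∫ ω, |X ω - x| ^ p ∂P) := by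
  have h1 : MemLp (fun ω => X ω - x) (ENNReal.ofReal p) P := hX.sub (memLp_const x)
  rw [ofReal_integral_eq_lintegral_ofReal (int_rpow (by linarith) le_rfl h1)
    (Filter.Eventually.of_forall fun ω => by positivity)]

lemma phi_lt {p : ℝ} (hp : 2 < p) {X : Ω → ℝ} (hX : MemLp X (ENNReal.ofReal p) P) {x y : ℝ}
    (hx : ∫ ω, psi p (x - X ω) ∂P = 0) (hxy : y ≠ x) :
    ∫⁻ ω, ENNReal.ofReal (|X ω - x| ^ p) ∂P < ∫⁻ ω, ENNReal.ofReal (|X ω - y| ^ p) ∂P := by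
  rw [phi_eq hp hX, phi_eq hp hX]
  exact (ENNReal.ofReal_lt_ofReal_iff_of_nonneg (integral_nonneg fun ω => by positivity)).2
    (min_lt hp hX hx hxy)

lemma phi_le {p : ℝ} (hp : 2 < p) {X : Ω → ℝ} (hX : MemLp X (ENNReal.ofReal p) P) {x : ℝ} (y : ℝ)
    (hx : ∫ ω, psi p (x - X ω) ∂P = 0) :
    ∫⁻ ω, ENNReal.ofReal (|X ω - x| ^ p) ∂P ≤ ∫⁻ ω, ENNReal.ofReal (|X ω - y| ^ p) ∂P := by
  rcases eq_or_ne y x with rfl | h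
  · exact le_rfl
  · exact (phi_lt hp hX hx h).le

lemma run_meas {T p : ℝ} {X : ℝ → Ω → ℝ} (hXm : Measurable (Function.uncurry X))
    {F : ℝ → ℝ} (hF : ContinuousOn F (Icc 0 T)) :
    AEMeasurable (Function.uncurry fun ω t => ENNReal.ofReal (|X t ω - F t| ^ p))
      (P.prod (volume.restrict (Ioc 0 T))) := by
  have h1 : AEStronglyMeasurable F (volume.restrict (Ioc 0 T)) :=
    (hF.mono Ioc_subset_Icc_self).aestronglyMeasurable measurableSet_Ioc
  have h2 : AEMeasurable (fun x : Ω × ℝ => F x.2) (P.prod (volume.restrict (Ioc 0 T))) :=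
    h1.comp_snd.aemeasurable
  have h3 : AEMeasurable (fun x : Ω × ℝ => X x.2 x.1) (P.prod (volume.restrict (Ioc 0 T))) :=
    (hXm.comp measurable_swap).aemeasurable
  have h4 := ((h3.sub h2).norm.pow_const p).ennreal_ofReal
  exact h4

lemma run_swap {T p : ℝ} {X : ℝ → Ω → ℝ} (hXm : Measurable (Function.uncurry X))
    {F : ℝ → ℝ} (hF : ContinuousOn F (Icc 0 T)) :
    powRunCost P T p X F = ∫⁻ t in Ioc 0 T, ∫⁻ ω, ENNReal.ofReal (|X t ω - F t| ^ p) ∂P :=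
  lintegral_lintegral_swap (run_meas hXm hF)

lemma run_le {T p : ℝ} (hp : 2 < p) {X : ℝ → Ω → ℝ} (hXm : Measurable (Function.uncurry X))
    (hX : ∀ t, MemLp (X t) (ENNReal.ofReal p) P)
    {F G : ℝ → ℝ} (hF : ContinuousOn F (Icc 0 T)) (hG : ContinuousOn G (Icc 0 T))
    (hr : ∀ t ∈ Ioc 0 T, ∫ ω, psi p (F t - X t ω) ∂P = 0) :
    powRunCost P T p X F ≤ powRunCost P T p X G := by
  rw [run_swap hXm hF, run_swap hXm hG]
  exact setLIntegral_mono' measurableSet_Ioc fun t ht => phi_le hp (hX t) _ (hr t ht)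

lemma run_uniq {T p : ℝ} (hT : 0 < T) (hp : 2 < p) {X : ℝ → Ω → ℝ} (hXm : Measurable (Function.uncurry X))
    (hX : ∀ t, MemLp (X t) (ENNReal.ofReal p) P)
    {F G : ℝ → ℝ} (hF : ContinuousOn F (Icc 0 T)) (hG : ContinuousOn G (Icc 0 T))
    (hr : ∀ t ∈ Ioc 0 T, ∫ ω, psi p (F t - X t ω) ∂P = 0)
    (hfin : powRunCost P T p X F ≠ ∞)
    (hle : powRunCost P T p X G ≤ powRunCost P T p X F) : ∀ t ∈ Icc 0 T, G t = F t := by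
  rw [run_swap hXm hF] at hfin
  rw [run_swap hXm hF, run_swap hXm hG] at hle
  have h1 := ae_eq_of_ae_le_of_lintegral_le
    ((ae_restrict_iff' measurableSet_Ioc).2 (Filter.Eventually.of_forall fun t ht =>
      phi_le hp (hX t) (G t) (hr t ht))) hfin
    ((run_meas (P := P) (p := p) hXm hG).prod_swap.lintegral_prod_right') hle
  have h2 : G =ᵐ[volume.restrict (Icc 0 T)] F := by
    rw [← restrict_Ioc_eq_restrict_Icc]
    filter_upwards [h1, ae_restrict_mem measurableSet_Ioc] with t ht ht'
    by_contra hc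
    exact (phi_lt hp (hX t) (hr t ht') hc).ne ht
  exact Measure.eqOn_Icc_of_ae_eq volume hT.ne h2 hG hF

lemma el_uniq {T p : ℝ} (hT : 0 < T) (hp : 2 < p) {X : ℝ → Ω → ℝ}
    (hX : ∀ t, MemLp (X t) (ENNReal.ofReal p) P)
    {F G : ℝ → ℝ} (hF : ContinuousOn F (Icc 0 T)) (hG : ContinuousOn G (Icc 0 T))
    (hr : ∀ t ∈ Ioo 0 T, ∫ ω, psi p (F t - X t ω) ∂P = 0)
    (hr' : ∀ t ∈ Ioo 0 T, ∫ ω, psi p (G t - X t ω) ∂P = 0) : ∀ t ∈ Icc 0 T, G t = F t := by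
  have h2 : G =ᵐ[volume.restrict (Icc 0 T)] F := by
    rw [← restrict_Ioo_eq_restrict_Icc]
    filter_upwards [ae_restrict_mem measurableSet_Ioo] with t ht
    exact (g_strictMono hp (hX t)).injective ((hr' t ht).trans (hr t ht).symm)
  exact Measure.eqOn_Icc_of_ae_eq volume hT.ne h2 hG hF

end cost

section constr
variable {Ω : Type*} [MeasurableSpace Ω] {P : Measure Ω} [IsProbabilityMeasure P]

def yy {Ω : Type*} (T : ℝ) (E : ℝ → ℝ) (z : ℝ → Ω → ℝ) (s : ℝ) (ω : Ω) : ℝ :=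
  (Ioc 0 T).indicator (fun s => max (z s ω * E s) 0) s

lemma good_yy {T p M : ℝ} (hT : 0 < T) (hp : 2 < p) {E : ℝ → ℝ} (hE : Measurable E) (hE0 : ∀ t, 0 ≤ E t)
    (hEM : ∀ t, E t ≤ M)
    {z : ℝ → Ω → ℝ} (hzmeas : Measurable (Function.uncurry z))
    (hi : ∀ t ∈ Set.Icc (0:ℝ) T, Integrable (fun ω => |z t ω| ^ p) P)
    (hii : IntegrableOn (fun t => ∫ ω, |z t ω| ^ p ∂P) (Set.Ioc 0 T)) : Good P T p (yy T E z) := by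
  have hmeas : Measurable (Function.uncurry (yy T E z)) := by
    have : Function.uncurry (yy T E z) = (Prod.fst ⁻¹' (Ioc 0 T)).indicator
        (fun x : ℝ × Ω => max (z x.1 x.2 * E x.1) 0) := by
      ext ⟨s, ω⟩; simp [yy, Function.uncurry, indicator]
    rw [this]
    refine Measurable.indicator ?_ (measurable_fst measurableSet_Ioc)
    exact (Measurable.mul hzmeas (hE.comp measurable_fst)).max measurable_const
  have hnn : ∀ r ω, 0 ≤ yy T E z r ω := fun r ω => indicator_nonneg (fun _ _ => le_max_right _ _) r
  have hM : 0 ≤ M := (hE0 0).trans (hEM 0)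
  have hle : ∀ r ω, yy T E z r ω ^ p ≤ (Ioc 0 T).indicator (fun r => M ^ p * |z r ω| ^ p) r := by
    intro r ω
    by_cases hr : r ∈ Ioc 0 T
    · rw [indicator_of_mem hr, ← Real.mul_rpow hM (abs_nonneg _)]
      refine Real.rpow_le_rpow (hnn r ω) ?_ (by linarith)
      simp only [yy, indicator_of_mem hr]
      refine max_le ?_ (by positivity)
      have h1 : z r ω * E r ≤ |z r ω| * E r := mul_le_mul_of_nonneg_right (le_abs_self _) (hE0 r)
      have h2 : |z r ω| * E r ≤ |z r ω| * M := mul_le_mul_of_nonneg_left (hEM r) (abs_nonneg _)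
      linarith
    · simp only [yy, indicator_of_notMem hr]
      rw [Real.zero_rpow (by linarith)]
  have hintp : ∀ r, Integrable (fun ω => yy T E z r ω ^ p) P := by
    intro r
    have hm : Measurable (fun ω => yy T E z r ω ^ p) := (hmeas.comp measurable_prodMk_left).pow_const p
    by_cases hr : r ∈ Ioc 0 T
    · refine ((hi r ⟨hr.1.le, hr.2⟩).const_mul (M ^ p)).mono' hm.aestronglyMeasurable
        (Filter.Eventually.of_forall fun ω => ?_)
      rw [Real.norm_of_nonneg (Real.rpow_nonneg (hnn _ _) _)]
      have := hle r ω
      rwa [indicator_of_mem hr] at this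
    · have : (fun ω => yy T E z r ω ^ p) = fun _ => 0 := by
        ext ω
        simp only [yy, indicator_of_notMem hr]
        rw [Real.zero_rpow (by linarith)]
      rw [this]; exact integrable_zero _ _ _
  refine ⟨hmeas, hnn, fun r hr ω => indicator_of_notMem hr _, hintp, ?_⟩
  have hm : StronglyMeasurable (fun r => ∫ ω, yy T E z r ω ^ p ∂P) :=
    StronglyMeasurable.integral_prod_right' (f := fun x : ℝ × Ω => yy T E z x.1 x.2 ^ p)
      (hmeas.pow_const p).stronglyMeasurable
  have hd : Integrable ((Ioc 0 T).indicator (fun r => M ^ p * ∫ ω, |z r ω| ^ p ∂P)) :=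
    IntegrableOn.integrable_indicator (hii.const_mul _) measurableSet_Ioc
  refine hd.mono' hm.aestronglyMeasurable (Filter.Eventually.of_forall fun r => ?_)
  rw [Real.norm_of_nonneg (integral_nonneg fun ω => Real.rpow_nonneg (hnn _ _) _)]
  by_cases hr : r ∈ Ioc 0 T
  · rw [indicator_of_mem hr, ← integral_const_mul]
    refine integral_mono (hintp r) ((hi r ⟨hr.1.le, hr.2⟩).const_mul (M ^ p)) fun ω => ?_
    have := hle r ω
    rwa [indicator_of_mem hr] at this
  · rw [indicator_of_notMem hr]
    refine integral_nonpos fun ω => ?_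
    have := hle r ω
    rwa [indicator_of_notMem hr] at this

lemma yy_eq {T : ℝ} {E : ℝ → ℝ} (hE0 : ∀ t, 0 ≤ E t)
    {z : ℝ → Ω → ℝ} (hzmeas : Measurable (Function.uncurry z))
    (hiii : ∀ t ∈ Set.Ioc (0:ℝ) T, ∀ᵐ ω ∂P, 0 < z t ω) :
    ∀ᵐ ω ∂P, ∀ t ∈ Icc 0 T, YY (yy T E z) t ω = ∫ s in (0:ℝ)..t, z s ω * E s := by
  have hm : MeasurableSet {x : ℝ × Ω | 0 < z x.1 x.2} := measurableSet_lt measurable_const hzmeas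
  have h1 : ∀ᵐ s ∂(volume.restrict (Ioc 0 T)), ∀ᵐ ω ∂P, 0 < z s ω :=
    (ae_restrict_iff' measurableSet_Ioc).2 (Filter.Eventually.of_forall hiii)
  have h2 := (Measure.ae_ae_comm hm).1 h1
  filter_upwards [h2] with ω hω t ht
  rw [intervalIntegral.integral_of_le ht.1, ← integral_indicator measurableSet_Ioc, YY]
  rw [ae_restrict_iff' measurableSet_Ioc] at hω
  refine integral_congr_ae ?_
  filter_upwards [hω] with s hs
  by_cases h : s ∈ Ioc 0 t
  · have h3 : s ∈ Ioc 0 T := ⟨h.1, h.2.trans ht.2⟩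
    rw [indicator_of_mem h, indicator_of_mem (show s ∈ Iic t from h.2), yy, indicator_of_mem h3,
      max_eq_left (mul_nonneg (hs h3).le (hE0 s))]
  · rw [indicator_of_notMem h]
    by_cases h4 : s ≤ t
    · have h5 : s ∉ Ioc 0 T := fun h' => h ⟨h'.1, h4⟩
      rw [indicator_of_mem (show s ∈ Iic t from h4), yy, indicator_of_notMem h5]
    · rw [indicator_of_notMem (show s ∉ Iic t from h4)]

end constr

/-- power cost functionals, `p > 2`. -/
theorem stmt_11 {Ω : Type*} [MeasurableSpace Ω] (P : Measure Ω) [IsProbabilityMeasure P]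
    (T : ℝ) (hT : 0 < T) (a : ℝ → ℝ) (ha : IntegrableOn a (Set.Ioc 0 T))
    (A : ℝ → ℝ) (hA : ∀ t, A t = ∫ s in (0:ℝ)..t, a s)
    (z : ℝ → Ω → ℝ) (hzmeas : Measurable (Function.uncurry z))
    (hpaths : ∀ᵐ ω ∂P, IntegrableOn (fun s => z s ω) (Set.Ioc 0 T))
    (Z : ℝ → Ω → ℝ)
    (hZ : ∀ t ω, Z t ω = Real.exp (A t) * ∫ s in (0:ℝ)..t, z s ω * Real.exp (-(A s)))
    (p : ℝ) (hp : 2 < p)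
    -- (i) E[|z(t)|^p] < ∞ for every t
    (hi : ∀ t ∈ Set.Icc (0:ℝ) T, Integrable (fun ω => |z t ω| ^ p) P)
    -- (ii) t ↦ E[|z(t)|^p] belongs to L¹(0,T)
    (hii : IntegrableOn (fun t => ∫ ω, |z t ω| ^ p ∂P) (Set.Ioc 0 T))
    -- (iii) z(t) > 0 almost surely for every t ∈ (0,T]
    (hiii : ∀ t ∈ Set.Ioc (0:ℝ) T, ∀ᵐ ω ∂P, 0 < z t ω)
    -- (iv) (t,x) ↦ (∂/∂t) E[|x − Z(t)|^{p−2}(x − Z(t))] exists and is continuous,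
    -- where g(t,x) = E[|x − Z(t)|^{p−2}(x − Z(t))]
    (g : ℝ → ℝ → ℝ)
    (hg : ∀ t x, g t x = ∫ ω, |x - Z t ω| ^ (p - 2) * (x - Z t ω) ∂P)
    (hivd : ∀ x t : ℝ, DifferentiableAt ℝ (fun s => g s x) t)
    (hivc : Continuous fun q : ℝ × ℝ => deriv (fun s => g s q.2) q.1) :
    -- constant final cost: for every C ≥ 0 there is a unique minimizer F_p ∈ 𝒜,
    -- characterized by the Euler–Lagrange equation
    (∀ C : ℝ, 0 ≤ C → ∃ Fp : ℝ → ℝ, AbsContZero T Fp ∧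
      (∀ G, AbsContZero T G →
        powRunCost P T p Z Fp + ENNReal.ofReal C ≤ powRunCost P T p Z G + ENNReal.ofReal C) ∧
      (∀ G, AbsContZero T G →
        (∀ H, AbsContZero T H →
          powRunCost P T p Z G + ENNReal.ofReal C ≤ powRunCost P T p Z H + ENNReal.ofReal C) →
        ∀ t ∈ Set.Icc (0:ℝ) T, G t = Fp t) ∧
      (∀ t ∈ Set.Ioo (0:ℝ) T,
        ∫ ω, |Fp t - Z t ω| ^ (p - 2) * (Fp t - Z t ω) ∂P = 0) ∧
      (∀ G, AbsContZero T G →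
        (∀ t ∈ Set.Ioo (0:ℝ) T,
          ∫ ω, |G t - Z t ω| ^ (p - 2) * (G t - Z t ω) ∂P = 0) →
        ∀ t ∈ Set.Icc (0:ℝ) T, G t = Fp t)) ∧
    -- final cost Φ_p: existence and uniqueness also hold
    (∃ Fp : ℝ → ℝ, AbsContZero T Fp ∧
      (∀ G, AbsContZero T G →
        powRunCost P T p Z Fp + powTermCost P T p Z Fp ≤
          powRunCost P T p Z G + powTermCost P T p Z G) ∧
      (∀ G, AbsContZero T G →
        (∀ H, AbsContZero T H →
          powRunCost P T p Z G + powTermCost P T p Z G ≤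
            powRunCost P T p Z H + powTermCost P T p Z H) →
        ∀ t ∈ Set.Icc (0:ℝ) T, G t = Fp t)) := by
  have haI : IntervalIntegrable a volume 0 T := (intervalIntegrable_iff_integrableOn_Ioc_of_le hT.le).2 ha
  have hAac : AbsolutelyContinuousOnInterval A 0 T := by
    have h1 := haI.absolutelyContinuousOnInterval_intervalIntegral (c := 0) (by simp)
    have h2 : A = fun t => ∫ s in (0:ℝ)..t, a s := funext hA
    rw [h2]; exact h1
  have hAcont : ContinuousOn A (Icc 0 T) := acz_cont hT ⟨a, ha, fun t _ => hA t⟩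
  -- clamped version of the function A
  let B : ℝ → ℝ := fun t => A (projIcc 0 T hT.le t)
  have hBc : Continuous B :=
    (continuousOn_iff_continuous_domRestrict.1 hAcont).comp continuous_projIcc
  have hBA : ∀ t ∈ Icc 0 T, B t = A t := fun t ht => by simp only [B, projIcc_of_mem hT.le ht]
  obtain ⟨M, hM⟩ : ∃ M, ∀ t, |B t| ≤ M := by
    obtain ⟨M, hM⟩ := isCompact_Icc.exists_bound_of_continuousOn hAcont
    exact ⟨M, fun t => hM _ (projIcc 0 T hT.le t).2⟩
  set E : ℝ → ℝ := fun t => Real.exp (-(B t)) with hEdef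
  have hE0 : ∀ t, 0 ≤ E t := fun t => (Real.exp_pos _).le
  set y := yy T E z with hy
  have hgood : Good P T p y := good_yy (M := Real.exp M) hT hp
    (Real.continuous_exp.comp hBc.neg).measurable hE0
    (fun t => Real.exp_le_exp.2 ((neg_le_abs _).trans (hM t))) hzmeas hi hii
  set X : ℝ → Ω → ℝ := fun t ω => Real.exp (B t) * YY y t ω with hX
  have hZX : ∀ᵐ ω ∂P, ∀ t ∈ Icc 0 T, Z t ω = X t ω := by
    filter_upwards [yy_eq (P := P) hE0 hzmeas hiii] with ω hω t ht
    rw [hZ, hX]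
    simp only
    rw [hω t ht, hBA t ht]
    congr 1
    refine intervalIntegral.integral_congr fun s hs => ?_
    rw [uIcc_of_le ht.1] at hs
    simp only [hEdef]
    rw [hBA s ⟨hs.1, hs.2.trans ht.2⟩]
  have hXm : Measurable (Function.uncurry X) :=
    Measurable.mul ((Real.continuous_exp.comp hBc).measurable.comp measurable_fst) hgood.YY_meas
  have hXL : ∀ t, MemLp (X t) (ENNReal.ofReal p) P := fun t => (hgood.YY_memLp hp hT t).const_mul _
  have hrun : ∀ F, powRunCost P T p Z F = powRunCost P T p X F := by
    intro F
    refine lintegral_congr_ae ?_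
    filter_upwards [hZX] with ω hω
    exact setLIntegral_congr_fun measurableSet_Ioc fun t ht => by
      simp only [hω t ⟨ht.1.le, ht.2⟩]
  have hterm : ∀ F, powTermCost P T p Z F = powTermCost P T p X F := by
    intro F
    refine lintegral_congr_ae ?_
    filter_upwards [hZX] with ω hω
    simp only [hω T ⟨hT.le, le_rfl⟩]
  have hEL : ∀ t ∈ Icc 0 T, ∀ x : ℝ, ∫ ω, |x - Z t ω| ^ (p - 2) * (x - Z t ω) ∂P =
      ∫ ω, psi p (x - X t ω) ∂P := by
    intro t ht x
    refine integral_congr_ae ?_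
    filter_upwards [hZX] with ω hω
    simp only [hω t ht, psi]
  obtain ⟨R, hRac, hR0, hRr⟩ := hgood.exists_R hp hT
  set F : ℝ → ℝ := fun t => Real.exp (A t) * R t with hF
  have hFacz : AbsContZero T F := by
    refine absContZero_of_ac hT ?_ (by simp [hF, hR0])
    exact (ac_exp hAac).fun_mul hRac
  have hFroot : ∀ t ∈ Icc 0 T, ∫ ω, psi p (F t - X t ω) ∂P = 0 := by
    intro t ht
    have h1 : ∀ ω, psi p (F t - X t ω) = psi p (Real.exp (A t)) * psi p (R t - YY y t ω) := by
      intro ω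
      simp only [hF, hX, hBA t ht, ← mul_sub, psi, abs_mul]
      rw [Real.mul_rpow (abs_nonneg _) (abs_nonneg _)]
      ring
    simp only [h1]
    rw [integral_const_mul, hRr t ht.1, mul_zero]
  have hFc := acz_cont hT hFacz
  have hIoc : ∀ t ∈ Ioc 0 T, ∫ ω, psi p (F t - X t ω) ∂P = 0 := fun t ht => hFroot t ⟨ht.1.le, ht.2⟩
  have hfin : powRunCost P T p X F ≠ ∞ := by
    refine ne_top_of_le_ne_top ?_ (run_le hp hXm hXL hFc (G := fun _ => 0) continuousOn_const hIoc)
    rw [run_swap hXm continuousOn_const]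
    have hBi := int_rpow (q := p) (by linarith) le_rfl (hgood.BB_memLp hp hT)
    have hb : ∀ t, ∫⁻ ω, ENNReal.ofReal (|X t ω - 0| ^ p) ∂P ≤
        ∫⁻ ω, ENNReal.ofReal (Real.exp M ^ p * |BB y ω| ^ p) ∂P := by
      intro t
      refine lintegral_mono_ae ?_
      filter_upwards [hgood.paths hp hT] with ω hω
      refine ENNReal.ofReal_le_ofReal ?_
      rw [← Real.mul_rpow (Real.exp_pos _).le (abs_nonneg _), sub_zero]
      refine Real.rpow_le_rpow (abs_nonneg _) ?_ (by linarith)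
      simp only [hX]
      rw [abs_mul, abs_of_pos (Real.exp_pos _), abs_of_nonneg (hgood.YY_nonneg t ω),
        abs_of_nonneg (hgood.BB_nonneg ω)]
      exact mul_le_mul (Real.exp_le_exp.2 ((le_abs_self _).trans (hM t))) (hgood.YY_le hω t)
        (hgood.YY_nonneg t ω) (Real.exp_pos _).le
    refine ne_top_of_le_ne_top ?_ (lintegral_mono hb)
    rw [lintegral_const]
    refine ENNReal.mul_ne_top ?_ (by simp)
    exact (hBi.const_mul (Real.exp M ^ p)).lintegral_lt_top.ne
  have htf : powTermCost P T p X F ≠ ∞ := by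
    unfold powTermCost
    rw [phi_eq hp (hXL T)]; exact ENNReal.ofReal_ne_top
  have hmin : ∀ G, AbsContZero T G → powRunCost P T p X F ≤ powRunCost P T p X G := fun G hG =>
    run_le hp hXm hXL hFc (acz_cont hT hG) hIoc
  have htmin : ∀ G, powTermCost P T p X F ≤ powTermCost P T p X G := fun G =>
    phi_le hp (hXL T) _ (hFroot T ⟨hT.le, le_rfl⟩)
  have huniq : ∀ G, AbsContZero T G → powRunCost P T p X G ≤ powRunCost P T p X F →
      ∀ t ∈ Icc 0 T, G t = F t := fun G hG hle =>
    run_uniq hT hp hXm hXL hFc (acz_cont hT hG) hIoc hfin hle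
  simp only [hrun, hterm]
  refine ⟨fun C _ => ⟨F, hFacz, fun G hG => add_le_add (hmin G hG) le_rfl, fun G hG hH => ?_, fun t ht => ?_,
    fun G hG hGr => ?_⟩, F, hFacz, fun G hG => add_le_add (hmin G hG) (htmin G), fun G hG hH => ?_⟩
  · exact huniq G hG ((ENNReal.add_le_add_iff_right ENNReal.ofReal_ne_top).1 (hH F hFacz))
  · rw [hEL t (Ioo_subset_Icc_self ht)]; exact hFroot t (Ioo_subset_Icc_self ht)
  · refine el_uniq hT hp hXL hFc (acz_cont hT hG) (fun t ht => hFroot t (Ioo_subset_Icc_self ht)) ?_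
    intro t ht
    rw [← hEL t (Ioo_subset_Icc_self ht)]; exact hGr t ht
  · refine huniq G hG ((ENNReal.add_le_add_iff_right htf).1 ?_)
    exact (add_le_add le_rfl (htmin G)).trans (hH F hFacz)
end
end

section
/- (Power cost functional, p = 2: the mean is the optimal approximation.) Let (Ω,ℱ,ℙ) be a probability space, T > 0, a ∈ L¹(0,T) with A(t) = ∫₀ᵗ a(s) ds, and let z : [0,T] × Ω → ℝ be jointly measurable with almost surely Lebesgue-integrable sample paths; define Z(t) = e^{A(t)} ∫₀ᵗ z(s) e^{−A(s)} ds. Suppose E[z(t)²] < ∞ for every t and t ↦ E[z(t)²] belongs to L¹(0,T). Then the function F₂(t) := E[Z(t)] = e^{A(t)} ∫₀ᵗ E[z(s)] e^{−A(s)} ds belongs to 𝒜 and is the unique minimizer over 𝒜 of the functional F ↦ E[∫₀ᵀ (Z(t) − F(t))² dt] (and also of F ↦ E[∫₀ᵀ (Z(t) − F(t))² dt + (Z(T) − F(T))²]); moreover the corresponding control f₂(t) = F₂′(t) − a(t)F₂(t) satisfies f₂(t) = E[z(t)] for almost every t. -/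
open MeasureTheory Set
open scoped ENNReal NNReal

noncomputable section

/-- The quadratic running cost `E[∫₀ᵀ (Z(t) − F(t))² dt]`, valued in `ℝ≥0∞`. -/
def quadRunCost {Ω : Type*} [MeasurableSpace Ω] (P : Measure Ω) (T : ℝ)
    (Z : ℝ → Ω → ℝ) (F : ℝ → ℝ) : ℝ≥0∞ :=
  ∫⁻ ω, (∫⁻ t in Set.Ioc 0 T, ENNReal.ofReal ((Z t ω - F t) ^ 2)) ∂P

/-- The quadratic terminal cost `E[(Z(T) − F(T))²]`, valued in `ℝ≥0∞`. -/
def quadTermCost {Ω : Type*} [MeasurableSpace Ω] (P : Measure Ω) (T : ℝ)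
    (Z : ℝ → Ω → ℝ) (F : ℝ → ℝ) : ℝ≥0∞ :=
  ∫⁻ ω, ENNReal.ofReal ((Z T ω - F T) ^ 2) ∂P

open Filter Topology

theorem aux_var {Ω : Type*} [MeasurableSpace Ω] (P : Measure Ω) [IsProbabilityMeasure P]
    (X : Ω → ℝ) (hX : MemLp X 2 P) (c : ℝ) :
    ∫⁻ ω, ENNReal.ofReal ((X ω - c) ^ 2) ∂P =
      ∫⁻ ω, ENNReal.ofReal ((X ω - ∫ ω', X ω' ∂P) ^ 2) ∂P +
        ENNReal.ofReal (((∫ ω', X ω' ∂P) - c) ^ 2) := by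
  set m := ∫ ω', X ω' ∂P with hm
  have h1 : Integrable X P := hX.integrable (by norm_num)
  have hsq : ∀ d : ℝ, Integrable (fun ω => (X ω - d) ^ 2) P := fun d =>
    (hX.sub (memLp_const d)).integrable_sq
  rw [← ofReal_integral_eq_lintegral_ofReal (hsq c) (ae_of_all _ fun ω => sq_nonneg _),
    ← ofReal_integral_eq_lintegral_ofReal (hsq m) (ae_of_all _ fun ω => sq_nonneg _),
    ← ENNReal.ofReal_add (integral_nonneg fun ω => sq_nonneg _) (sq_nonneg _)]
  congr 1
  have : ∀ ω, (X ω - c) ^ 2 = (X ω - m) ^ 2 + (2 * (m - c) * (X ω - m) + (m - c) ^ 2) := by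
    intro ω; ring
  simp_rw [this]
  have h2 : Integrable (fun ω => X ω - m) P := h1.sub (integrable_const m)
  have h3 : Integrable (fun ω => 2 * (m - c) * (X ω - m) + (m - c) ^ 2) P :=
    (h2.const_mul _).add (integrable_const _)
  rw [integral_add (hsq m) h3,
    integral_add (h2.const_mul _) (integrable_const _), integral_const_mul,
    integral_sub h1 (integrable_const m)]
  simp [← hm]

theorem aux_cs (T : ℝ) (hT : 0 < T) (w : ℝ → ℝ) (hw : IntegrableOn w (Ioc 0 T))
    (hw2 : IntegrableOn (fun s => w s ^ 2) (Ioc 0 T)) (t : ℝ) (ht : t ∈ Icc 0 T) :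
    (∫ s in (0:ℝ)..t, w s) ^ 2 ≤ T * ∫ s in Ioc 0 T, w s ^ 2 := by
  have h1 : |∫ s in (0:ℝ)..t, w s| ≤ ∫ s in Ioc 0 T, |w s| := by
    rw [intervalIntegral.integral_of_le ht.1]
    refine (abs_integral_le_integral_abs).trans ?_
    exact setIntegral_mono_set hw.abs (ae_of_all _ fun _ => abs_nonneg _)
      (Ioc_subset_Ioc_right ht.2).eventuallyLE
  set J := ∫ s in Ioc 0 T, |w s| with hJ
  have hJ0 : 0 ≤ J := integral_nonneg fun _ => abs_nonneg _
  have h2 : (0:ℝ) ≤ ∫ s in Ioc 0 T, (|w s| - J / T) ^ 2 := integral_nonneg fun _ => sq_nonneg _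
  have e : ∀ s, (|w s| - J / T) ^ 2 = w s ^ 2 + ((-2 * (J / T)) * |w s| + (J / T) ^ 2) := by
    intro s; rw [sub_sq, sq_abs]; ring
  simp_rw [e] at h2
  have hc : IntegrableOn (fun _ : ℝ => (J / T) ^ 2) (Ioc 0 T) := by
    simp [integrableOn_const_iff]
  have ha : IntegrableOn (fun s => (-2 * (J / T)) * |w s|) (Ioc 0 T) := hw.abs.const_mul _
  have hac : IntegrableOn (fun s => (-2 * (J / T)) * |w s| + (J / T) ^ 2) (Ioc 0 T) := ha.add hc
  rw [integral_add hw2 hac, integral_add ha hc, integral_const_mul, ← hJ] at h2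
  simp only [setIntegral_const, Measure.real, Real.volume_Ioc, sub_zero,
    ENNReal.toReal_ofReal hT.le, smul_eq_mul] at h2
  have h3 : J ^ 2 ≤ T * ∫ s in Ioc 0 T, w s ^ 2 := by
    have := mul_nonneg hT.le h2
    field_simp at this
    nlinarith
  calc _ = |∫ s in (0:ℝ)..t, w s| ^ 2 := (sq_abs _).symm
    _ ≤ J ^ 2 := by gcongr
    _ ≤ _ := h3

theorem aux_exp_ac {f : ℝ → ℝ} {a b : ℝ} (hf : AbsolutelyContinuousOnInterval f a b) :
    AbsolutelyContinuousOnInterval (fun t => Real.exp (f t)) a b := by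
  obtain ⟨C, hC⟩ := hf.exists_bound
  obtain ⟨K, hK⟩ := (Real.contDiff_exp (n := 1)).contDiffOn.exists_lipschitzOnWith (by decide)
    (convex_Icc (-C) C) isCompact_Icc
  have hd : ∀ x ∈ uIcc a b, ∀ y ∈ uIcc a b,
      dist (Real.exp (f x)) (Real.exp (f y)) ≤ K * dist (f x) (f y) := fun x hx y hy =>
    hK.dist_le_mul _ (abs_le.1 (hC x hx)) _ (abs_le.1 (hC y hy))
  rw [absolutelyContinuousOnInterval_iff] at hf ⊢
  intro ε hε
  obtain ⟨δ, hδ, h⟩ := hf (ε / (K + 1)) (by positivity)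
  refine ⟨δ, hδ, fun E hE hlt => ?_⟩
  have h1 := h E hE hlt
  calc _ ≤ ∑ i ∈ Finset.range E.1, (K + 1) * dist (f (E.2 i).1) (f (E.2 i).2) := by
        refine Finset.sum_le_sum fun i hi => ?_
        have := hE.1 i hi
        refine (hd _ this.1 _ this.2).trans ?_
        gcongr; linarith
    _ < ε := by
        rw [← Finset.mul_sum]
        rw [lt_div_iff₀ (by positivity)] at h1
        linarith

theorem aux_absCont {T : ℝ} (hT : 0 < T) {F : ℝ → ℝ} (hF : AbsContZero T F) :
    ContinuousOn F (Icc 0 T) := by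
  obtain ⟨f, hf, h⟩ := hF
  have hi : IntervalIntegrable f volume 0 T := (intervalIntegrable_iff_integrableOn_Ioc_of_le hT.le).2 hf
  have := (hi.absolutelyContinuousOnInterval_intervalIntegral (c := 0) (by simp)).continuousOn
  rw [uIcc_of_le hT.le] at this
  exact this.congr h

theorem aux_ode (T : ℝ) (hT : 0 < T) (a e A F : ℝ → ℝ) (ha : IntegrableOn a (Ioc 0 T))
    (he : IntegrableOn e (Ioc 0 T)) (hA : ∀ t, A t = ∫ s in (0:ℝ)..t, a s)
    (hF : ∀ t ∈ Icc (0:ℝ) T, F t = Real.exp (A t) * ∫ s in (0:ℝ)..t, e s * Real.exp (-(A s))) :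
    AbsContZero T F ∧
    ∀ᵐ t ∂(volume.restrict (Ioo 0 T)), deriv F t - a t * F t = e t := by
  have hu : uIcc 0 T = Icc 0 T := uIcc_of_le hT.le
  have hai : IntervalIntegrable a volume 0 T := (intervalIntegrable_iff_integrableOn_Ioc_of_le hT.le).2 ha
  have hA' : A = fun t => ∫ s in (0:ℝ)..t, a s := funext hA
  have hAac : AbsolutelyContinuousOnInterval A 0 T := by
    rw [hA']; exact hai.absolutelyContinuousOnInterval_intervalIntegral (by simp)
  have hei : IntervalIntegrable (fun s => e s * Real.exp (-(A s))) volume 0 T :=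
    ((intervalIntegrable_iff_integrableOn_Ioc_of_le hT.le).2 he).mul_continuousOn
      (Real.continuous_exp.comp_continuousOn hAac.continuousOn.neg)
  set V : ℝ → ℝ := fun t => ∫ s in (0:ℝ)..t, e s * Real.exp (-(A s)) with hV
  have hVac : AbsolutelyContinuousOnInterval V 0 T :=
    hei.absolutelyContinuousOnInterval_intervalIntegral (by simp)
  have hUV := (aux_exp_ac hAac).fun_mul hVac
  constructor
  · refine ⟨deriv (fun t => Real.exp (A t) * V t), ?_, fun t ht => ?_⟩
    · exact (intervalIntegrable_iff_integrableOn_Ioc_of_le hT.le).1 hUV.intervalIntegrable_deriv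
    · rw [(hUV.mono (c := 0) (d := t) ?_).integral_deriv_eq_sub, hF t ht]
      · simp [hV]
      · rw [hu, uIcc_of_le ht.1]; exact Icc_subset_Icc_right ht.2
  · rw [ae_restrict_iff' measurableSet_Ioo]
    filter_upwards [hai.ae_hasDerivAt_integral, hei.ae_hasDerivAt_integral] with t h1 h2 ht
    have ht' : t ∈ uIcc 0 T := hu ▸ Ioo_subset_Icc_self ht
    have d1 : HasDerivAt A (a t) t := by
      rw [hA']; exact h1 ht' 0 (by simp)
    have d2 : HasDerivAt V (e t * Real.exp (-(A t))) t := h2 ht' 0 (by simp)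
    have d3 := d1.exp.mul d2
    have : F =ᶠ[𝓝 t] (fun t => Real.exp (A t)) * V := by
      filter_upwards [Ioo_mem_nhds ht.1 ht.2] with x hx
      exact hF x (Ioo_subset_Icc_self hx)
    rw [(d3.congr_of_eventuallyEq this).deriv, hF t (Ioo_subset_Icc_self ht), Real.exp_neg]
    have := Real.exp_ne_zero (A t)
    change _ * V t + _ - a t * (_ * V t) = _
    field_simp
    ring

theorem aux_opt {Ω : Type*} [MeasurableSpace Ω] (P : Measure Ω) [IsProbabilityMeasure P]
    (T : ℝ) (hT : 0 < T) (Z Zm : ℝ → Ω → ℝ) (hZm : Measurable (Function.uncurry Zm))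
    (hZ : ∀ t ∈ Icc (0:ℝ) T, ∀ ω, Z t ω = Zm t ω)
    (D : Ω → ℝ) (hD : Integrable D P)
    (hb : ∀ t ∈ Icc (0:ℝ) T, ∀ᵐ ω ∂P, Z t ω ^ 2 ≤ D ω)
    (F : ℝ → ℝ) (hF : ∀ t, F t = ∫ ω, Z t ω ∂P) (hFc : ContinuousOn F (Icc 0 T)) :
    quadRunCost P T Z F ≠ ∞ ∧ quadTermCost P T Z F ≠ ∞ ∧
    ∀ G, ContinuousOn G (Icc 0 T) →
      quadRunCost P T Z G = quadRunCost P T Z F +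
        ∫⁻ t in Ioc 0 T, ENNReal.ofReal ((F t - G t) ^ 2) ∧
      quadTermCost P T Z G = quadTermCost P T Z F + ENNReal.ofReal ((F T - G T) ^ 2) := by
  have hTm : T ∈ Icc (0:ℝ) T := ⟨hT.le, le_rfl⟩
  have hmem : ∀ t ∈ Icc (0:ℝ) T, MemLp (Z t) 2 P := by
    intro t ht
    have hm : Measurable (Z t) := by
      have : Z t = fun ω => Zm t ω := funext (hZ t ht)
      rw [this]
      exact hZm.comp (measurable_const.prodMk measurable_id)
    rw [memLp_two_iff_integrable_sq hm.aestronglyMeasurable]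
    refine hD.mono' (hm.pow_const 2).aestronglyMeasurable ?_
    filter_upwards [hb t ht] with ω h
    rwa [Real.norm_of_nonneg (sq_nonneg _)]
  have hvar : ∀ t ∈ Icc (0:ℝ) T, ∀ c, ∫⁻ ω, ENNReal.ofReal ((Z t ω - c) ^ 2) ∂P =
      ∫⁻ ω, ENNReal.ofReal ((Z t ω - F t) ^ 2) ∂P + ENNReal.ofReal ((F t - c) ^ 2) := by
    intro t ht c
    rw [hF t]
    exact aux_var P (Z t) (hmem t ht) c
  have hbd : ∀ t ∈ Icc (0:ℝ) T, ∫⁻ ω, ENNReal.ofReal ((Z t ω - F t) ^ 2) ∂P ≤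
      ∫⁻ ω, ENNReal.ofReal (D ω) ∂P := by
    intro t ht
    calc _ ≤ ∫⁻ ω, ENNReal.ofReal ((Z t ω - 0) ^ 2) ∂P := by
          rw [hvar t ht 0]; exact le_self_add
      _ ≤ _ := by
          refine lintegral_mono_ae ?_
          filter_upwards [hb t ht] with ω h
          rw [sub_zero]
          exact ENNReal.ofReal_le_ofReal h
  have hDfin : ∫⁻ ω, ENNReal.ofReal (D ω) ∂P < ∞ := hD.lintegral_lt_top
  have hswap : ∀ G, ContinuousOn G (Icc 0 T) → quadRunCost P T Z G =
      ∫⁻ t in Ioc 0 T, ∫⁻ ω, ENNReal.ofReal ((Z t ω - G t) ^ 2) ∂P := by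
    intro G hG
    have hGm : AEMeasurable G (volume.restrict (Ioc 0 T)) :=
      (hG.mono Ioc_subset_Icc_self).aemeasurable measurableSet_Ioc
    have e1 : quadRunCost P T Z G =
        ∫⁻ ω, (∫⁻ t in Ioc 0 T, ENNReal.ofReal ((Zm t ω - G t) ^ 2)) ∂P := by
      refine lintegral_congr fun ω => setLIntegral_congr_fun measurableSet_Ioc fun t ht => ?_
      simp only [hZ t (Ioc_subset_Icc_self ht)]
    rw [e1, lintegral_lintegral_swap]
    · refine setLIntegral_congr_fun measurableSet_Ioc fun t ht => ?_
      simp only [hZ t (Ioc_subset_Icc_self ht)]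
    · have m1 : Measurable (fun p : Ω × ℝ => Zm p.2 p.1) := hZm.comp measurable_swap
      exact ((m1.aemeasurable.sub hGm.comp_snd).pow_const 2).ennreal_ofReal
  refine ⟨?_, ((hbd T hTm).trans_lt hDfin).ne, fun G hG => ⟨?_, hvar T hTm (G T)⟩⟩
  · rw [hswap F hFc]
    refine ((setLIntegral_mono' measurableSet_Ioc fun t ht =>
      hbd t (Ioc_subset_Icc_self ht)).trans_lt ?_).ne
    rw [setLIntegral_const, Real.volume_Ioc]
    exact ENNReal.mul_lt_top hDfin ENNReal.ofReal_lt_top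
  · rw [hswap G hG, hswap F hFc, ← lintegral_add_right']
    · exact setLIntegral_congr_fun measurableSet_Ioc fun t ht =>
        hvar t (Ioc_subset_Icc_self ht) (G t)
    · exact (((hFc.sub hG).mono Ioc_subset_Icc_self).aemeasurable
        measurableSet_Ioc).pow_const 2 |>.ennreal_ofReal

theorem aux_eq (T : ℝ) (hT : 0 < T) (F G : ℝ → ℝ) (hF : ContinuousOn F (Icc 0 T))
    (hG : ContinuousOn G (Icc 0 T))
    (h : ∫⁻ t in Ioc 0 T, ENNReal.ofReal ((F t - G t) ^ 2) = 0) :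
    ∀ t ∈ Icc (0:ℝ) T, G t = F t := by
  have hm : AEMeasurable (fun t => ENNReal.ofReal ((F t - G t) ^ 2))
      (volume.restrict (Ioc 0 T)) :=
    (((hF.sub hG).mono Ioc_subset_Icc_self).aemeasurable
        measurableSet_Ioc).pow_const 2 |>.ennreal_ofReal
  rw [lintegral_eq_zero_iff' hm, restrict_Ioc_eq_restrict_Icc] at h
  refine Measure.eqOn_Icc_of_ae_eq volume hT.ne ?_ hG hF
  filter_upwards [h] with t ht
  have h1 : (F t - G t) ^ 2 ≤ 0 := ENNReal.ofReal_eq_zero.1 ht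
  nlinarith

theorem aux_data {Ω : Type*} [MeasurableSpace Ω] (P : Measure Ω) [IsProbabilityMeasure P]
    (T : ℝ) (hT : 0 < T) (A : ℝ → ℝ) (hA : ContinuousOn A (Icc 0 T))
    (z : ℝ → Ω → ℝ) (hzmeas : Measurable (Function.uncurry z))
    (Z : ℝ → Ω → ℝ)
    (hZ : ∀ t ω, Z t ω = Real.exp (A t) * ∫ s in (0:ℝ)..t, z s ω * Real.exp (-(A s)))
    (hi : ∀ t ∈ Set.Icc (0:ℝ) T, Integrable (fun ω => (z t ω) ^ 2) P)
    (hii : IntegrableOn (fun t => ∫ ω, (z t ω) ^ 2 ∂P) (Set.Ioc 0 T)) :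
    (∀ t ∈ Icc (0:ℝ) T, ∫ ω, Z t ω ∂P =
      Real.exp (A t) * ∫ s in (0:ℝ)..t, (∫ ω, z s ω ∂P) * Real.exp (-(A s))) ∧
    IntegrableOn (fun t => ∫ ω, z t ω ∂P) (Ioc 0 T) ∧
    ∃ Zm : ℝ → Ω → ℝ, Measurable (Function.uncurry Zm) ∧
      (∀ t ∈ Icc (0:ℝ) T, ∀ ω, Z t ω = Zm t ω) ∧
      ∃ D : Ω → ℝ, Integrable D P ∧ ∀ t ∈ Icc (0:ℝ) T, ∀ᵐ ω ∂P, Z t ω ^ 2 ≤ D ω := by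
  set μ := volume.restrict (Ioc 0 T) with hμ
  -- continuous extension of `A`
  obtain ⟨B, hBc, hBA⟩ : ∃ B : ℝ → ℝ, Continuous B ∧ ∀ t ∈ Icc (0:ℝ) T, B t = A t := by
    refine ⟨fun t => A (max 0 (min t T)), hA.comp_continuous (by fun_prop) fun t => ?_, fun t ht => ?_⟩
    · exact ⟨le_max_left _ _, max_le hT.le (min_le_right _ _)⟩
    · simp only [min_eq_left ht.2, max_eq_right ht.1]
  obtain ⟨M, hM⟩ := isCompact_Icc.exists_bound_of_continuousOn (hBc.continuousOn (s := Icc 0 T))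
  have hM0 : ∀ t ∈ Icc (0:ℝ) T, -M ≤ B t ∧ B t ≤ M := fun t ht => abs_le.1 (hM t ht)
  set w : ℝ → Ω → ℝ := fun s ω => z s ω * Real.exp (-(B s)) with hw
  have hwm : Measurable (Function.uncurry w) := by
    have : Measurable fun p : ℝ × Ω => Real.exp (-(B p.1)) :=
      (Real.measurable_exp.comp (hBc.measurable.neg)).comp measurable_fst
    exact hzmeas.mul this
  have hz2 : Integrable (fun p : ℝ × Ω => z p.1 p.2 ^ 2) (μ.prod P) := by
    refine (integrable_prod_iff (hzmeas.pow_const 2).aestronglyMeasurable).2 ?_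
    simp only [Function.uncurry]
    refine ⟨(ae_restrict_iff' measurableSet_Ioc).2 (ae_of_all _ fun t ht =>
      hi t (Ioc_subset_Icc_self ht)), ?_⟩
    simpa [abs_of_nonneg, sq_nonneg, IntegrableOn, ← hμ] using hii
  have hz1 : Integrable (fun p : ℝ × Ω => z p.1 p.2) (μ.prod P) :=
    ((memLp_two_iff_integrable_sq hzmeas.aestronglyMeasurable).2 hz2).integrable (by norm_num)
  have hfst : ∀ᵐ p ∂(μ.prod P), p.1 ∈ Ioc 0 T :=
    Measure.quasiMeasurePreserving_fst.ae (ae_restrict_mem measurableSet_Ioc)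
  have hw1 : Integrable (Function.uncurry w) (μ.prod P) := by
    refine (hz1.norm.const_mul (Real.exp M)).mono' hwm.aestronglyMeasurable ?_
    filter_upwards [hfst] with p hp
    simp only [Function.uncurry, hw, norm_mul, Real.norm_eq_abs, Real.abs_exp]
    rw [mul_comm]
    gcongr
    linarith [(hM0 _ (Ioc_subset_Icc_self hp)).1]
  have hw2 : Integrable (fun p : ℝ × Ω => w p.1 p.2 ^ 2) (μ.prod P) := by
    refine (hz2.const_mul (Real.exp M ^ 2)).mono' (hwm.pow_const 2).aestronglyMeasurable ?_
    filter_upwards [hfst] with p hp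
    rw [Real.norm_of_nonneg (sq_nonneg _)]
    simp only [hw, mul_pow]
    rw [mul_comm]
    gcongr
    linarith [(hM0 _ (Ioc_subset_Icc_self hp)).1]
  have hZw : ∀ t ∈ Icc (0:ℝ) T, ∀ ω, Z t ω = Real.exp (B t) * ∫ s in (0:ℝ)..t, w s ω := by
    intro t ht ω
    rw [hZ, hBA t ht]
    congr 1
    refine intervalIntegral.integral_congr fun s hs => ?_
    rw [uIcc_of_le ht.1] at hs
    simp only [hw, hBA s ⟨hs.1, hs.2.trans ht.2⟩]
  refine ⟨fun t ht => ?_, hz1.integral_prod_left, ?_⟩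
  · simp_rw [hZw t ht]
    rw [integral_const_mul, hBA t ht]
    congr 1
    simp_rw [intervalIntegral.integral_of_le ht.1]
    have hle : (volume.restrict (Ioc 0 t)).prod P ≤ μ.prod P :=
      Measure.prod_mono (Measure.restrict_mono (Ioc_subset_Ioc_right ht.2) le_rfl) le_rfl
    rw [← integral_integral_swap (hw1.mono_measure hle)]
    refine setIntegral_congr_fun measurableSet_Ioc fun s hs => ?_
    simp only [hw]
    rw [integral_mul_const, hBA s ⟨hs.1.le, hs.2.trans ht.2⟩]
  · refine ⟨fun t ω => Real.exp (B t) * ∫ s, (if s ≤ t then w s ω else 0) ∂μ, ?_, ?_, ?_⟩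
    · have m1 : Measurable fun q : (ℝ × Ω) × ℝ => if q.2 ≤ q.1.1 then w q.2 q.1.2 else 0 := by
        refine Measurable.ite (measurableSet_le measurable_snd (measurable_fst.comp measurable_fst))
          ?_ measurable_const
        exact hwm.comp (measurable_snd.prodMk (measurable_snd.comp measurable_fst))
      have m2 := (m1.stronglyMeasurable.integral_prod_right' (ν := μ)).measurable
      exact ((Real.measurable_exp.comp hBc.measurable).comp measurable_fst).mul m2
    · intro t ht ω
      rw [hZw t ht ω]
      congr 1
      have : (fun s => if s ≤ t then w s ω else 0) = (Iic t).indicator (fun s => w s ω) := by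
        ext s; simp [indicator]
      rw [this, integral_indicator measurableSet_Iic, hμ, Measure.restrict_restrict measurableSet_Iic,
        intervalIntegral.integral_of_le ht.1, inter_comm, Ioc_inter_Iic, min_eq_right ht.2]
    · refine ⟨fun ω => Real.exp M ^ 2 * (T * ∫ s in Ioc 0 T, w s ω ^ 2), ?_, fun t ht => ?_⟩
      · exact (hw2.integral_prod_right.const_mul T).const_mul _
      · filter_upwards [hw1.prod_left_ae, hw2.prod_left_ae] with ω h1 h2
        rw [hZw t ht ω, mul_pow]
        gcongr
        · exact (hM0 t ht).2
        · exact aux_cs T hT (fun s => w s ω) h1 h2 t ht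

/-- power cost functional, `p = 2`: the mean `F₂(t) = E[Z(t)]` is the
unique minimizer of the quadratic cost over `𝒜`, and the corresponding control is
`f₂(t) = E[z(t)]`. -/
theorem stmt_12 {Ω : Type*} [MeasurableSpace Ω] (P : Measure Ω) [IsProbabilityMeasure P]
    (T : ℝ) (hT : 0 < T) (a : ℝ → ℝ) (ha : IntegrableOn a (Set.Ioc 0 T))
    (A : ℝ → ℝ) (hA : ∀ t, A t = ∫ s in (0:ℝ)..t, a s)
    (z : ℝ → Ω → ℝ) (hzmeas : Measurable (Function.uncurry z))
    (hpaths : ∀ᵐ ω ∂P, IntegrableOn (fun s => z s ω) (Set.Ioc 0 T))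
    (Z : ℝ → Ω → ℝ)
    (hZ : ∀ t ω, Z t ω = Real.exp (A t) * ∫ s in (0:ℝ)..t, z s ω * Real.exp (-(A s)))
    -- E[z(t)²] < ∞ for every t
    (hi : ∀ t ∈ Set.Icc (0:ℝ) T, Integrable (fun ω => (z t ω) ^ 2) P)
    -- t ↦ E[z(t)²] belongs to L¹(0,T)
    (hii : IntegrableOn (fun t => ∫ ω, (z t ω) ^ 2 ∂P) (Set.Ioc 0 T))
    -- F₂(t) := E[Z(t)]
    (F₂ : ℝ → ℝ) (hF₂ : ∀ t, F₂ t = ∫ ω, Z t ω ∂P) :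
    -- F₂(t) = e^{A(t)} ∫₀ᵗ E[z(s)] e^{−A(s)} ds
    (∀ t ∈ Set.Icc (0:ℝ) T,
      F₂ t = Real.exp (A t) * ∫ s in (0:ℝ)..t, (∫ ω, z s ω ∂P) * Real.exp (-(A s))) ∧
    -- F₂ ∈ 𝒜
    AbsContZero T F₂ ∧
    -- F₂ minimizes the quadratic running cost over 𝒜, and is the unique minimizer
    (∀ G, AbsContZero T G → quadRunCost P T Z F₂ ≤ quadRunCost P T Z G) ∧
    (∀ G, AbsContZero T G →
      (∀ H, AbsContZero T H → quadRunCost P T Z G ≤ quadRunCost P T Z H) →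
      ∀ t ∈ Set.Icc (0:ℝ) T, G t = F₂ t) ∧
    -- the same with the quadratic terminal cost added
    (∀ G, AbsContZero T G →
      quadRunCost P T Z F₂ + quadTermCost P T Z F₂ ≤
        quadRunCost P T Z G + quadTermCost P T Z G) ∧
    (∀ G, AbsContZero T G →
      (∀ H, AbsContZero T H →
        quadRunCost P T Z G + quadTermCost P T Z G ≤
          quadRunCost P T Z H + quadTermCost P T Z H) →
      ∀ t ∈ Set.Icc (0:ℝ) T, G t = F₂ t) ∧
    -- the corresponding control f₂ = F₂′ − aF₂ equals E[z(t)] a.e.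
    (∀ᵐ t ∂(volume.restrict (Set.Ioo 0 T)),
      deriv F₂ t - a t * F₂ t = ∫ ω, z t ω ∂P) := by
  have hAc : ContinuousOn A (Icc 0 T) := aux_absCont hT ⟨a, ha, fun t _ => hA t⟩
  obtain ⟨h1, hez, Zm, hZm, hZZ, D, hD, hb⟩ := aux_data P T hT A hAc z hzmeas Z hZ hi hii
  simp_rw [← hF₂] at h1
  obtain ⟨hac, hder⟩ := aux_ode T hT a _ A F₂ ha hez hA h1
  have hFc := aux_absCont hT hac
  obtain ⟨f1, f2, hG⟩ := aux_opt P T hT Z Zm hZm hZZ D hD hb F₂ hF₂ hFc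
  refine ⟨h1, hac, fun G g => ?_, fun G g hmin => ?_, fun G g => ?_, fun G g hmin => ?_, hder⟩
  · rw [(hG G (aux_absCont hT g)).1]; exact le_self_add
  · refine aux_eq T hT F₂ G hFc (aux_absCont hT g) ?_
    have h := hmin F₂ hac
    rw [(hG G (aux_absCont hT g)).1] at h
    have h' : quadRunCost P T Z F₂ + _ ≤ quadRunCost P T Z F₂ + 0 := h.trans_eq (add_zero _).symm
    exact le_zero_iff.1 ((ENNReal.add_le_add_iff_left f1).1 h')
  · rw [(hG G (aux_absCont hT g)).1, (hG G (aux_absCont hT g)).2]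
    exact add_le_add le_self_add le_self_add
  · refine aux_eq T hT F₂ G hFc (aux_absCont hT g) ?_
    have h := hmin F₂ hac
    rw [(hG G (aux_absCont hT g)).1, (hG G (aux_absCont hT g)).2] at h
    have h' := (add_le_add_right (le_self_add (a := quadTermCost P T Z F₂)
      (b := ENNReal.ofReal ((F₂ T - G T) ^ 2))) (quadRunCost P T Z F₂ +
        ∫⁻ t in Ioc 0 T, ENNReal.ofReal ((F₂ t - G t) ^ 2))).trans h
    have h2 : quadRunCost P T Z F₂ + _ ≤ quadRunCost P T Z F₂ + 0 :=
      ((ENNReal.add_le_add_iff_right f2).1 h').trans_eq (add_zero _).symm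
    exact le_zero_iff.1 ((ENNReal.add_le_add_iff_left f1).1 h2)
end
end

section
/- (Gaussian drift: all even-power optimal approximations coincide with the mean.) Let (Ω,ℱ,ℙ) be a probability space, T > 0, a ∈ L¹(0,T) with A(t) = ∫₀ᵗ a(s) ds, and let z : [0,T] × Ω → ℝ be jointly measurable with almost surely Lebesgue-integrable sample paths; define Z(t) = e^{A(t)} ∫₀ᵗ z(s) e^{−A(s)} ds. Let n ≥ 1 be an integer and suppose: (i) E[|z(t)|^{2n}] < ∞ for every t; (ii) t ↦ E[|z(t)|^{2n}] belongs to L¹(0,T); and (iii) for every t ∈ [0,T] the law of Z(t) is a (possibly degenerate) Gaussian distribution on ℝ. Then the functional F ↦ E[∫₀ᵀ |Z(t) − F(t)|^{2n} dt] (with constant terminal cost, or with terminal cost E[|Z(T) − F(T)|^{2n}]) admits a unique minimizer over 𝒜, namely F_{2n}(t) = E[Z(t)]; in particular the minimizer is the same for every n ≥ 1 and coincides with the quadratic-cost minimizer F₂. -/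
open MeasureTheory Set
open scoped ENNReal NNReal

noncomputable section

/-- The running cost of order `2n`, `E[∫₀ᵀ |Z(t) − F(t)|^{2n} dt]`, valued in `ℝ≥0∞`. -/
def evenRunCost {Ω : Type*} [MeasurableSpace Ω] (P : Measure Ω) (T : ℝ) (n : ℕ)
    (Z : ℝ → Ω → ℝ) (F : ℝ → ℝ) : ℝ≥0∞ :=
  ∫⁻ ω, (∫⁻ t in Set.Ioc 0 T, ENNReal.ofReal (|Z t ω - F t| ^ (2 * n))) ∂P

/-- The terminal cost of order `2n`, `E[|Z(T) − F(T)|^{2n}]`, valued in `ℝ≥0∞`. -/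
def evenTermCost {Ω : Type*} [MeasurableSpace Ω] (P : Measure Ω) (T : ℝ) (n : ℕ)
    (Z : ℝ → Ω → ℝ) (F : ℝ → ℝ) : ℝ≥0∞ :=
  ∫⁻ ω, ENNReal.ofReal (|Z T ω - F T| ^ (2 * n)) ∂P

theorem aux_ineq (x d : ℝ) (n : ℕ) (hn : 1 ≤ n) :
    2 * (|x| ^ (2 * n) + |d| ^ (2 * n)) ≤ |x - d| ^ (2 * n) + |-x - d| ^ (2 * n) := by
  have h1 : ((x - d) ^ 2 + (-x - d) ^ 2) ^ n ≤
      2 ^ (n - 1) * (((x - d) ^ 2) ^ n + ((-x - d) ^ 2) ^ n) :=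
    add_pow_le (sq_nonneg _) (sq_nonneg _) n
  have h2 : (x ^ 2) ^ n + (d ^ 2) ^ n ≤ (x ^ 2 + d ^ 2) ^ n :=
    pow_add_pow_le (sq_nonneg _) (sq_nonneg _) (by omega)
  have h3 : (x - d) ^ 2 + (-x - d) ^ 2 = 2 * (x ^ 2 + d ^ 2) := by ring
  rw [h3, mul_pow] at h1
  obtain ⟨k, rfl⟩ : ∃ k, n = k + 1 := ⟨n - 1, by omega⟩
  simp only [pow_mul, sq_abs]
  have h4 : (0:ℝ) < 2 ^ k := by positivity
  rw [show (2:ℝ) ^ (k+1) = 2 ^ k * 2 by ring, mul_assoc, Nat.add_sub_cancel] at h1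
  have h5 := le_of_mul_le_mul_left h1 h4
  linarith

theorem aux_gauss (m c : ℝ) (v : ℝ≥0) (n : ℕ) (hn : 1 ≤ n) :
    (∫⁻ x, ENNReal.ofReal (|x - m| ^ (2 * n)) ∂(ProbabilityTheory.gaussianReal m v)) +
      ENNReal.ofReal (|c - m| ^ (2 * n)) ≤
    ∫⁻ x, ENNReal.ofReal (|x - c| ^ (2 * n)) ∂(ProbabilityTheory.gaussianReal m v) := by
  set μ := ProbabilityTheory.gaussianReal m v with hμ
  have hsym : ∫⁻ x, ENNReal.ofReal (|x - c| ^ (2 * n)) ∂μ =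
      ∫⁻ x, ENNReal.ofReal (|(2 * m - x) - c| ^ (2 * n)) ∂μ := by
    have h : μ.map (fun x => 2 * m - x) = μ := by
      rw [hμ, ProbabilityTheory.gaussianReal_map_const_sub]; congr 1; ring
    conv_lhs => rw [← h]
    rw [lintegral_map (by fun_prop) (by fun_prop)]
  have key : 2 * ((∫⁻ x, ENNReal.ofReal (|x - m| ^ (2 * n)) ∂μ) +
      ENNReal.ofReal (|c - m| ^ (2 * n))) ≤
      2 * ∫⁻ x, ENNReal.ofReal (|x - c| ^ (2 * n)) ∂μ := by
    have e1 : (∫⁻ x, ENNReal.ofReal (|x - m| ^ (2 * n)) ∂μ) + ENNReal.ofReal (|c - m| ^ (2 * n)) =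
        ∫⁻ x, (ENNReal.ofReal (|x - m| ^ (2 * n)) + ENNReal.ofReal (|c - m| ^ (2 * n))) ∂μ := by
      rw [lintegral_add_right _ measurable_const, lintegral_const, measure_univ, mul_one]
    rw [e1, ← lintegral_const_mul _ (by fun_prop), two_mul (∫⁻ x, _ ∂μ)]
    nth_rw 2 [hsym]
    rw [← lintegral_add_left (by fun_prop)]
    apply lintegral_mono
    intro x
    simp only
    rw [← ENNReal.ofReal_add (by positivity) (by positivity),
      ← ENNReal.ofReal_add (by positivity) (by positivity),
      show (2:ℝ≥0∞) = ENNReal.ofReal 2 by simp, ← ENNReal.ofReal_mul (by norm_num)]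
    apply ENNReal.ofReal_le_ofReal
    have := aux_ineq (x - m) (c - m) n hn
    rwa [show x - m - (c - m) = x - c by ring,
      show -(x - m) - (c - m) = 2 * m - x - c by ring] at this
  exact (ENNReal.mul_le_mul_iff_right (by simp) (by simp)).1 key

theorem aux_exp_ac_s13 (T : ℝ) (hT : 0 ≤ T) (A : ℝ → ℝ)
    (hA : AbsolutelyContinuousOnInterval A 0 T) :
    AbsolutelyContinuousOnInterval (fun t => Real.exp (A t)) 0 T := by
  obtain ⟨C, hC⟩ := hA.exists_bound
  obtain ⟨K, hK⟩ := (Real.contDiff_exp (n := 1)).contDiffOn.exists_lipschitzOnWith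
    (by simp) (convex_Icc (-C) C) isCompact_Icc
  rw [absolutelyContinuousOnInterval_iff] at hA ⊢
  intro ε hε
  obtain ⟨δ, hδ, h⟩ := hA (ε / (K + 1)) (by positivity)
  refine ⟨δ, hδ, fun E hE hEd => ?_⟩
  have h1 := h E hE hEd
  have hmem : ∀ x ∈ uIcc 0 T, A x ∈ Icc (-C) C := fun x hx => by
    have := hC x hx
    rw [Real.norm_eq_abs, abs_le] at this
    exact this
  calc _ ≤ ∑ i ∈ Finset.range E.1, (K + 1 : ℝ) * dist (A (E.2 i).1) (A (E.2 i).2) := by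
        apply Finset.sum_le_sum
        intro i hi
        have := hK.dist_le_mul _ (hmem _ (hE.1 i hi).1) _ (hmem _ (hE.1 i hi).2)
        refine this.trans ?_
        gcongr
        linarith
    _ = (K + 1 : ℝ) * ∑ i ∈ Finset.range E.1, dist (A (E.2 i).1) (A (E.2 i).2) := by
        rw [Finset.mul_sum]
    _ < (K + 1 : ℝ) * (ε / (K + 1)) := by gcongr
    _ = ε := by field_simp

theorem aux_ac_to (T : ℝ) (hT : 0 ≤ T) (F : ℝ → ℝ) (G : ℝ → ℝ)
    (hG : AbsolutelyContinuousOnInterval G 0 T) (h0 : G 0 = 0)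
    (h : ∀ t ∈ Icc 0 T, F t = G t) : AbsContZero T F := by
  refine ⟨deriv G, ?_, fun t ht => ?_⟩
  · exact (intervalIntegrable_iff_integrableOn_Ioc_of_le hT).1 hG.intervalIntegrable_deriv
  · rw [h t ht]
    have : AbsolutelyContinuousOnInterval G 0 t := hG.mono (by
      rw [uIcc_of_le hT, uIcc_of_le ht.1]; exact Icc_subset_Icc_right ht.2)
    rw [this.integral_deriv_eq_sub, h0, sub_zero]

theorem aux_ac_of (T : ℝ) (hT : 0 ≤ T) (F : ℝ → ℝ) (hF : AbsContZero T F) :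
    ∃ F' : ℝ → ℝ, Continuous F' ∧ AbsolutelyContinuousOnInterval F' 0 T ∧ F' 0 = 0 ∧
      ∀ t ∈ Icc 0 T, F t = F' t := by
  obtain ⟨f, hf, h⟩ := hF
  have hi : Integrable ((Ioc 0 T).indicator f) := (integrable_indicator_iff measurableSet_Ioc).2 hf
  refine ⟨fun t => ∫ s in (0:ℝ)..t, (Ioc 0 T).indicator f s, ?_, ?_, by simp, fun t ht => ?_⟩
  · exact intervalIntegral.continuous_primitive (fun a b => hi.intervalIntegrable) 0
  · exact hi.intervalIntegrable.absolutelyContinuousOnInterval_intervalIntegral (by simp)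
  · beta_reduce
    rw [h t ht, intervalIntegral.integral_of_le ht.1, intervalIntegral.integral_of_le ht.1]
    apply setIntegral_congr_fun measurableSet_Ioc
    intro s hs
    have hs' : s ∈ Ioc 0 T := ⟨hs.1, hs.2.trans ht.2⟩
    rw [indicator_of_mem hs']

theorem aux_jensen {α : Type*} [MeasurableSpace α] (μ : Measure α) [IsFiniteMeasure μ] (k : ℕ)
    (hk : 1 ≤ k) : ∃ C : ℝ≥0∞, C ≠ ∞ ∧ ∀ f : α → ℝ, Measurable f →
      (∫⁻ x, ‖f x‖ₑ ∂μ) ^ k ≤ C * ∫⁻ x, ‖f x‖ₑ ^ k ∂μ := by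
  have hk0 : (0:ℝ) < k := by exact_mod_cast hk
  refine ⟨(μ univ ^ (1 / (1:ℝ) - 1 / (k:ℝ))) ^ k, ?_, fun f hf => ?_⟩
  · apply ENNReal.pow_ne_top
    apply ENNReal.rpow_ne_top_of_nonneg
    · have : 1 / (k:ℝ) ≤ 1 := by
        rw [div_le_one hk0]; exact_mod_cast hk
      linarith
    · exact measure_ne_top _ _
  · have := eLpNorm'_le_eLpNorm'_mul_rpow_measure_univ (μ := μ) (p := 1) (q := k) one_pos
      (by exact_mod_cast hk) (f := f) hf.aestronglyMeasurable
    simp only [eLpNorm', ENNReal.rpow_one, div_one, ENNReal.rpow_natCast] at this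
    calc _ ≤ ((∫⁻ x, ‖f x‖ₑ ^ k ∂μ) ^ (1 / (k:ℝ)) * μ univ ^ (1 / (1:ℝ) - 1 / (k:ℝ))) ^ k := by
          gcongr
          simpa using this
      _ = _ := by
          rw [mul_pow, mul_comm]
          congr 1
          rw [← ENNReal.rpow_natCast, ← ENNReal.rpow_mul, one_div_mul_cancel hk0.ne',
            ENNReal.rpow_one]

section aux
variable {Ω : Type*} [MeasurableSpace Ω] (P : Measure Ω) [IsProbabilityMeasure P]

theorem aux_pow_int (T : ℝ) (z : ℝ → Ω → ℝ) (hzmeas : Measurable (Function.uncurry z)) (n : ℕ)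
    (hi : ∀ t ∈ Set.Icc (0:ℝ) T, Integrable (fun ω => |z t ω| ^ (2 * n)) P)
    (hii : IntegrableOn (fun t => ∫ ω, |z t ω| ^ (2 * n) ∂P) (Set.Ioc 0 T)) :
    Integrable (fun p : ℝ × Ω => |z p.1 p.2| ^ (2 * n)) ((volume.restrict (Ioc 0 T)).prod P) := by
  have hm : Measurable (fun p : ℝ × Ω => z p.1 p.2) := hzmeas
  rw [integrable_prod_iff (by fun_prop)]
  constructor
  · filter_upwards [ae_restrict_mem measurableSet_Ioc] with t ht
    exact hi t (Ioc_subset_Icc_self ht)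
  · simpa [IntegrableOn] using hii

theorem aux_z_int (T : ℝ) (z : ℝ → Ω → ℝ) (hzmeas : Measurable (Function.uncurry z)) (n : ℕ)
    (hn : 1 ≤ n)
    (h : Integrable (fun p : ℝ × Ω => |z p.1 p.2| ^ (2 * n)) ((volume.restrict (Ioc 0 T)).prod P)) :
    Integrable (fun p : ℝ × Ω => z p.1 p.2) ((volume.restrict (Ioc 0 T)).prod P) := by
  have hm : Measurable (fun p : ℝ × Ω => z p.1 p.2) := hzmeas
  refine ((integrable_const (1:ℝ)).add h).mono' hm.aestronglyMeasurable
    (Filter.Eventually.of_forall fun p => ?_)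
  simp only [Pi.add_apply, Real.norm_eq_abs]
  rcases le_total (|z p.1 p.2|) 1 with h1 | h1
  · have : 0 ≤ |z p.1 p.2| ^ (2 * n) := by positivity
    linarith
  · have := le_self_pow₀ h1 (show 2 * n ≠ 0 by omega)
    linarith

theorem aux_y_int (T : ℝ) (z : ℝ → Ω → ℝ) (A : ℝ → ℝ) (hA : Continuous A)
    (h : Integrable (fun p : ℝ × Ω => z p.1 p.2) ((volume.restrict (Ioc 0 T)).prod P)) :
    Integrable (fun p : ℝ × Ω => z p.1 p.2 * Real.exp (-(A p.1)))
      ((volume.restrict (Ioc 0 T)).prod P) := by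
  obtain ⟨C, hC⟩ := (isCompact_Icc (a := (0:ℝ)) (b := T)).exists_bound_of_continuousOn
    (f := fun s => Real.exp (-(A s))) (by fun_prop)
  refine h.mul_bdd (c := C) (by fun_prop) ?_
  have : ∀ᵐ p ∂((volume.restrict (Ioc 0 T)).prod P), p.1 ∈ Ioc 0 T :=
    Measure.quasiMeasurePreserving_fst.ae (ae_restrict_mem measurableSet_Ioc)
  filter_upwards [this] with p hp
  exact hC _ (Ioc_subset_Icc_self hp)

theorem aux_F2 (T : ℝ) (hT : 0 < T) (z : ℝ → Ω → ℝ) (A : ℝ → ℝ) (hA : Continuous A)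
    (hAC : AbsolutelyContinuousOnInterval A 0 T)
    (h : Integrable (fun p : ℝ × Ω => z p.1 p.2 * Real.exp (-(A p.1)))
      ((volume.restrict (Ioc 0 T)).prod P))
    (F : ℝ → ℝ) (hF : ∀ t ∈ Icc 0 T, F t =
      ∫ ω, Real.exp (A t) * (∫ s in (0:ℝ)..t, z s ω * Real.exp (-(A s))) ∂P) :
    AbsContZero T F := by
  have hint : IntervalIntegrable (fun s => ∫ ω, z s ω * Real.exp (-(A s)) ∂P) volume 0 T :=
    (intervalIntegrable_iff_integrableOn_Ioc_of_le hT.le).2 h.integral_prod_left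
  refine aux_ac_to T hT.le F
    (fun t => Real.exp (A t) * ∫ s in (0:ℝ)..t, (∫ ω, z s ω * Real.exp (-(A s)) ∂P)) ?_ (by simp) ?_
  · exact (aux_exp_ac_s13 T hT.le A hAC).fun_mul
      (hint.absolutelyContinuousOnInterval_intervalIntegral (by simp))
  · intro t ht
    rw [hF t ht, integral_const_mul]
    congr 1
    simp only [intervalIntegral.integral_of_le ht.1]
    rw [integral_integral_swap]
    have h' := h.mono_measure (μ := (volume.restrict (Ioc 0 t)).prod P) (by
      apply Measure.prod_mono _ le_rfl
      exact Measure.restrict_mono (Ioc_subset_Ioc_right ht.2) le_rfl)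
    exact h'.swap

theorem aux_bound (T : ℝ) (z : ℝ → Ω → ℝ) (hzmeas : Measurable (Function.uncurry z))
    (A : ℝ → ℝ) (hA : Continuous A) (k : ℕ) (hk : 1 ≤ k) :
    ∃ C : ℝ≥0∞, C ≠ ∞ ∧ ∀ t ∈ Icc 0 T, ∀ ω,
      ENNReal.ofReal (|Real.exp (A t) * (∫ s in (0:ℝ)..t, z s ω * Real.exp (-(A s)))| ^ k) ≤
        C * ∫⁻ s in Ioc 0 T, ‖z s ω‖ₑ ^ k := by
  obtain ⟨C, hC⟩ := (isCompact_Icc (a := (0:ℝ)) (b := T)).exists_bound_of_continuousOn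
    (f := fun s => Real.exp (-(A s))) (by fun_prop)
  obtain ⟨D, hD⟩ := (isCompact_Icc (a := (0:ℝ)) (b := T)).exists_bound_of_continuousOn
    (f := fun s => Real.exp (A s)) (by fun_prop)
  obtain ⟨J, hJ, hJb⟩ := aux_jensen (volume.restrict (Ioc 0 T)) k hk
  refine ⟨(ENNReal.ofReal D * ENNReal.ofReal C) ^ k * J, by finiteness, fun t ht ω => ?_⟩
  have hzm : Measurable (fun s => z s ω) := hzmeas.comp (measurable_id.prodMk measurable_const)
  have e : ENNReal.ofReal
      (|Real.exp (A t) * (∫ s in (0:ℝ)..t, z s ω * Real.exp (-(A s)))| ^ k) =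
      (‖Real.exp (A t)‖ₑ * ‖∫ s in (0:ℝ)..t, z s ω * Real.exp (-(A s))‖ₑ) ^ k := by
    rw [ENNReal.ofReal_pow (abs_nonneg _), ← enorm_mul, Real.enorm_eq_ofReal_abs]
  rw [e]
  have b1 : ‖Real.exp (A t)‖ₑ ≤ ENNReal.ofReal D := by
    rw [← ofReal_norm]; exact ENNReal.ofReal_le_ofReal (hD t ht)
  have b2 : ‖∫ s in (0:ℝ)..t, z s ω * Real.exp (-(A s))‖ₑ ≤
      ENNReal.ofReal C * ∫⁻ s in Ioc 0 T, ‖z s ω‖ₑ := by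
    rw [intervalIntegral.integral_of_le ht.1, ← lintegral_const_mul _ (by fun_prop)]
    refine (enorm_integral_le_lintegral_enorm _).trans ?_
    refine (lintegral_mono_set (Ioc_subset_Ioc_right ht.2)).trans ?_
    refine setLIntegral_mono (by fun_prop) fun s hs => ?_
    rw [enorm_mul, mul_comm]
    gcongr
    rw [← ofReal_norm]; exact ENNReal.ofReal_le_ofReal (hC s (Ioc_subset_Icc_self hs))
  calc _ ≤ (ENNReal.ofReal D * (ENNReal.ofReal C * ∫⁻ s in Ioc 0 T, ‖z s ω‖ₑ)) ^ k := by gcongr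
    _ = (ENNReal.ofReal D * ENNReal.ofReal C) ^ k * (∫⁻ s in Ioc 0 T, ‖z s ω‖ₑ) ^ k := by
        rw [← mul_assoc, mul_pow]
    _ ≤ (ENNReal.ofReal D * ENNReal.ofReal C) ^ k * (J * ∫⁻ s in Ioc 0 T, ‖z s ω‖ₑ ^ k) := by
        gcongr; exact hJb _ hzm
    _ = _ := by rw [mul_assoc]

theorem aux_lint (T : ℝ) (z : ℝ → Ω → ℝ) (hzmeas : Measurable (Function.uncurry z)) (k : ℕ)
    (h : Integrable (fun p : ℝ × Ω => |z p.1 p.2| ^ k) ((volume.restrict (Ioc 0 T)).prod P)) :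
    ∫⁻ ω, (∫⁻ s in Ioc 0 T, ‖z s ω‖ₑ ^ k) ∂P ≠ ∞ := by
  have hm : Measurable (fun p : ℝ × Ω => z p.1 p.2) := hzmeas
  have := h.hasFiniteIntegral
  rw [HasFiniteIntegral, lintegral_prod_symm _ (by fun_prop)] at this
  refine ne_of_lt (lt_of_eq_of_lt ?_ this)
  simp [enorm_pow]

theorem aux_Zmeas (T : ℝ) (z : ℝ → Ω → ℝ) (hzmeas : Measurable (Function.uncurry z))
    (A : ℝ → ℝ) (hA : Continuous A) :
    ∃ Z' : ℝ → Ω → ℝ, Measurable (Function.uncurry Z') ∧ ∀ t ∈ Icc 0 T, ∀ ω,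
      Real.exp (A t) * (∫ s in (0:ℝ)..t, z s ω * Real.exp (-(A s))) = Z' t ω := by
  have hm : Measurable (fun p : ℝ × Ω => z p.1 p.2) := hzmeas
  refine ⟨fun t ω => Real.exp (A t) *
    ∫ s in Ioc 0 T, (Iic t).indicator (fun s => z s ω * Real.exp (-(A s))) s, ?_, ?_⟩
  · apply Measurable.mul
    · fun_prop
    · have : Measurable (fun q : (ℝ × Ω) × ℝ =>
          (Iic q.1.1).indicator (fun s => z s q.1.2 * Real.exp (-(A s))) q.2) := by
        have e : (fun q : (ℝ × Ω) × ℝ =>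
          (Iic q.1.1).indicator (fun s => z s q.1.2 * Real.exp (-(A s))) q.2) =
          {q : (ℝ × Ω) × ℝ | q.2 ≤ q.1.1}.indicator
            (fun q => z q.2 q.1.2 * Real.exp (-(A q.2))) := by
          ext q; simp [indicator]
        rw [e]
        apply Measurable.indicator
        · apply Measurable.mul
          · exact hm.comp (measurable_snd.prodMk (measurable_snd.comp measurable_fst))
          · fun_prop
        · exact measurableSet_le (by fun_prop) (by fun_prop)
      exact this.stronglyMeasurable.integral_prod_right'.measurable
  · intro t ht ω
    simp only
    rw [intervalIntegral.integral_of_le ht.1, setIntegral_indicator measurableSet_Iic]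
    congr 3
    ext s; simp only [mem_Ioc, mem_inter_iff, mem_Iic]
    constructor
    · intro h; exact ⟨⟨h.1, h.2.trans ht.2⟩, h.2⟩
    · intro h; exact ⟨h.1.1, h.2⟩

theorem aux_swap (T : ℝ) (Z Z' : ℝ → Ω → ℝ) (hZ' : Measurable (Function.uncurry Z'))
    (hZZ : ∀ t ∈ Icc 0 T, ∀ ω, Z t ω = Z' t ω) (n : ℕ) (G G' : ℝ → ℝ) (hG' : Continuous G')
    (hG : ∀ t ∈ Icc 0 T, G t = G' t) :
    evenRunCost P T n Z G =
      ∫⁻ t in Ioc 0 T, (∫⁻ ω, ENNReal.ofReal (|Z t ω - G t| ^ (2 * n)) ∂P) := by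
  have hm : Measurable (fun p : ℝ × Ω => Z' p.1 p.2) := hZ'
  have hs : Measurable (fun p : Ω × ℝ => Z' p.2 p.1) := hm.comp measurable_swap
  unfold evenRunCost
  have e1 : ∀ ω, ∫⁻ t in Ioc 0 T, ENNReal.ofReal (|Z t ω - G t| ^ (2 * n)) =
      ∫⁻ t in Ioc 0 T, ENNReal.ofReal (|Z' t ω - G' t| ^ (2 * n)) := fun ω =>
    setLIntegral_congr_fun measurableSet_Ioc fun t ht => by
      rw [hZZ t (Ioc_subset_Icc_self ht), hG t (Ioc_subset_Icc_self ht)]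
  simp only [e1]
  rw [lintegral_lintegral_swap]
  · refine setLIntegral_congr_fun measurableSet_Ioc fun t ht => ?_
    rw [hG t (Ioc_subset_Icc_self ht)]
    simp only [hZZ t (Ioc_subset_Icc_self ht)]
  · refine Measurable.aemeasurable ?_
    simp only [Function.uncurry_def]
    fun_prop

end aux

/-- Gaussian drift: if `Z(t)` is Gaussian for every `t`, then for every
`n ≥ 1` the unique minimizer over `𝒜` of the `2n`-power cost (with constant terminal
cost, or with terminal cost `E[|Z(T) − F(T)|^{2n}]`) is `F_{2n}(t) = E[Z(t)]`; in
particular it is the same for every `n` and coincides with the quadratic minimizer. -/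
theorem stmt_13 {Ω : Type*} [MeasurableSpace Ω] (P : Measure Ω) [IsProbabilityMeasure P]
    (T : ℝ) (hT : 0 < T) (a : ℝ → ℝ) (ha : IntegrableOn a (Set.Ioc 0 T))
    (A : ℝ → ℝ) (hA : ∀ t, A t = ∫ s in (0:ℝ)..t, a s)
    (z : ℝ → Ω → ℝ) (hzmeas : Measurable (Function.uncurry z))
    (hpaths : ∀ᵐ ω ∂P, IntegrableOn (fun s => z s ω) (Set.Ioc 0 T))
    (Z : ℝ → Ω → ℝ)
    (hZ : ∀ t ω, Z t ω = Real.exp (A t) * ∫ s in (0:ℝ)..t, z s ω * Real.exp (-(A s)))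
    (n : ℕ) (hn : 1 ≤ n)
    -- (i) E[|z(t)|^{2n}] < ∞ for every t
    (hi : ∀ t ∈ Set.Icc (0:ℝ) T, Integrable (fun ω => |z t ω| ^ (2 * n)) P)
    -- (ii) t ↦ E[|z(t)|^{2n}] belongs to L¹(0,T)
    (hii : IntegrableOn (fun t => ∫ ω, |z t ω| ^ (2 * n) ∂P) (Set.Ioc 0 T))
    -- (iii) the law of Z(t) is a (possibly degenerate) Gaussian for every t ∈ [0,T]
    (hiii : ∀ t ∈ Set.Icc (0:ℝ) T, ∃ (m : ℝ) (v : ℝ≥0),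
      Measure.map (fun ω => Z t ω) P = ProbabilityTheory.gaussianReal m v)
    -- F₂(t) := E[Z(t)]
    (F₂ : ℝ → ℝ) (hF₂ : ∀ t, F₂ t = ∫ ω, Z t ω ∂P) :
    -- F₂ ∈ 𝒜 and, for the constant-terminal-cost problem, F₂ is the unique minimizer
    AbsContZero T F₂ ∧
    (∀ G, AbsContZero T G → evenRunCost P T n Z F₂ ≤ evenRunCost P T n Z G) ∧
    (∀ G, AbsContZero T G →
      (∀ H, AbsContZero T H → evenRunCost P T n Z G ≤ evenRunCost P T n Z H) →
      ∀ t ∈ Set.Icc (0:ℝ) T, G t = F₂ t) ∧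
    -- and likewise with the terminal cost E[|Z(T) − F(T)|^{2n}]
    (∀ G, AbsContZero T G →
      evenRunCost P T n Z F₂ + evenTermCost P T n Z F₂ ≤
        evenRunCost P T n Z G + evenTermCost P T n Z G) ∧
    (∀ G, AbsContZero T G →
      (∀ H, AbsContZero T H →
        evenRunCost P T n Z G + evenTermCost P T n Z G ≤
          evenRunCost P T n Z H + evenTermCost P T n Z H) →
      ∀ t ∈ Set.Icc (0:ℝ) T, G t = F₂ t) := by
  obtain ⟨A', hA'c, hA'ac, -, hAA'⟩ := aux_ac_of T hT.le A ⟨a, ha, fun t _ => hA t⟩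
  have hZA : ∀ t ∈ Icc 0 T, ∀ ω, Z t ω =
      Real.exp (A' t) * ∫ s in (0:ℝ)..t, z s ω * Real.exp (-(A' s)) := by
    intro t ht ω
    rw [hZ, hAA' t ht]
    congr 1
    apply intervalIntegral.integral_congr
    intro s hs
    rw [uIcc_of_le ht.1] at hs
    beta_reduce
    rw [hAA' s ⟨hs.1, hs.2.trans ht.2⟩]
  have hpow := aux_pow_int P T z hzmeas n hi hii
  have hyint := aux_y_int P T z A' hA'c (aux_z_int P T z hzmeas n hn hpow)
  have hF2ac : AbsContZero T F₂ := aux_F2 P T hT z A' hA'c hA'ac hyint F₂ fun t ht => by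
    rw [hF₂]
    simp only [hZA t ht]
  obtain ⟨Z', hZ'm, hZ'⟩ := aux_Zmeas T z hzmeas A' hA'c
  have hZZ : ∀ t ∈ Icc 0 T, ∀ ω, Z t ω = Z' t ω := fun t ht ω => by
    rw [hZA t ht, hZ' t ht]
  have hZtm : ∀ t ∈ Icc 0 T, Measurable (Z t) := fun t ht => by
    rw [show Z t = Z' t from funext (hZZ t ht)]
    exact hZ'm.comp (measurable_const.prodMk measurable_id)
  -- pointwise inequality
  have hpt : ∀ t ∈ Icc 0 T, ∀ c : ℝ,
      (∫⁻ ω, ENNReal.ofReal (|Z t ω - F₂ t| ^ (2 * n)) ∂P) +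
        ENNReal.ofReal (|c - F₂ t| ^ (2 * n)) ≤
      ∫⁻ ω, ENNReal.ofReal (|Z t ω - c| ^ (2 * n)) ∂P := by
    intro t ht c
    obtain ⟨m, v, hmv⟩ := hiii t ht
    have hm : F₂ t = m := by
      rw [hF₂, ← ProbabilityTheory.integral_id_gaussianReal (μ := m) (v := v), ← hmv,
        integral_map (hZtm t ht).aemeasurable (by fun_prop)]
    have := aux_gauss m c v n hn
    rw [← hmv, lintegral_map (by fun_prop) (hZtm t ht),
      lintegral_map (by fun_prop) (hZtm t ht)] at this
    rw [hm]
    exact this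
  obtain ⟨F', hF'c, -, -, hFF'⟩ := aux_ac_of T hT.le F₂ hF2ac
  have hrun : ∀ G, AbsContZero T G → evenRunCost P T n Z F₂ +
      (∫⁻ t in Ioc 0 T, ENNReal.ofReal (|G t - F₂ t| ^ (2 * n))) ≤ evenRunCost P T n Z G := by
    intro G hG
    obtain ⟨G', hG'c, -, -, hGG'⟩ := aux_ac_of T hT.le G hG
    rw [aux_swap P T Z Z' hZ'm hZZ n G G' hG'c hGG', aux_swap P T Z Z' hZ'm hZZ n F₂ F' hF'c hFF']
    have e : ∫⁻ t in Ioc 0 T, ENNReal.ofReal (|G t - F₂ t| ^ (2 * n)) =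
        ∫⁻ t in Ioc 0 T, ENNReal.ofReal (|G' t - F' t| ^ (2 * n)) :=
      setLIntegral_congr_fun measurableSet_Ioc fun t ht => by
        rw [hGG' t (Ioc_subset_Icc_self ht), hFF' t (Ioc_subset_Icc_self ht)]
    rw [e, ← lintegral_add_right _ (by fun_prop)]
    refine lintegral_mono_ae ?_
    filter_upwards [ae_restrict_mem measurableSet_Ioc] with t ht
    have ht' := Ioc_subset_Icc_self ht
    rw [← hGG' t ht', ← hFF' t ht']
    exact hpt t ht' (G t)
  have hterm : ∀ G : ℝ → ℝ, evenTermCost P T n Z F₂ ≤ evenTermCost P T n Z G := fun G =>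
    le_self_add.trans (hpt T ⟨hT.le, le_rfl⟩ (G T))
  have hrun' : ∀ G, AbsContZero T G → evenRunCost P T n Z F₂ ≤ evenRunCost P T n Z G :=
    fun G hG => le_self_add.trans (hrun G hG)
  -- finiteness
  have h0 : AbsContZero T (fun _ => 0) := ⟨fun _ => 0, by simp, by simp⟩
  obtain ⟨C, hC, hCb⟩ := aux_bound T z hzmeas A' hA'c (2 * n) (by omega)
  have hfin0 := aux_lint P T z hzmeas (2 * n) hpow
  have hfinI : ∫⁻ ω, C * (∫⁻ s in Ioc 0 T, ‖z s ω‖ₑ ^ (2 * n)) ∂P ≠ ∞ := by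
    rw [lintegral_const_mul' _ _ hC]
    finiteness
  have hZb : ∀ t ∈ Icc 0 T, ∀ ω, ENNReal.ofReal (|Z t ω - 0| ^ (2 * n)) ≤
      C * (∫⁻ s in Ioc 0 T, ‖z s ω‖ₑ ^ (2 * n)) := fun t ht ω => by
    rw [sub_zero, hZA t ht]; exact hCb t ht ω
  have hrunfin : evenRunCost P T n Z F₂ ≠ ∞ := by
    refine ne_top_of_le_ne_top ?_ (hrun' _ h0)
    have hle : evenRunCost P T n Z (fun _ => 0) ≤
        ∫⁻ ω, (C * (∫⁻ s in Ioc 0 T, ‖z s ω‖ₑ ^ (2 * n))) * ENNReal.ofReal T ∂P := by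
      refine lintegral_mono fun ω => ?_
      refine (setLIntegral_mono' measurableSet_Ioc
        fun t ht => hZb t (Ioc_subset_Icc_self ht) ω).trans ?_
      simp
    refine ne_top_of_le_ne_top ?_ hle
    rw [lintegral_mul_const' _ _ (by finiteness)]
    finiteness
  have htermfin : evenTermCost P T n Z F₂ ≠ ∞ := by
    refine ne_top_of_le_ne_top ?_ (hterm (fun _ => 0))
    exact ne_top_of_le_ne_top hfinI (lintegral_mono fun ω => hZb T ⟨hT.le, le_rfl⟩ ω)
  -- uniqueness
  have huniq : ∀ G, AbsContZero T G →
      ∫⁻ t in Ioc 0 T, ENNReal.ofReal (|G t - F₂ t| ^ (2 * n)) = 0 →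
      ∀ t ∈ Icc (0:ℝ) T, G t = F₂ t := by
    intro G hG h
    obtain ⟨G', hG'c, -, -, hGG'⟩ := aux_ac_of T hT.le G hG
    have e : ∫⁻ t in Ioc 0 T, ENNReal.ofReal (|G t - F₂ t| ^ (2 * n)) =
        ∫⁻ t in Ioc 0 T, ENNReal.ofReal (|G' t - F' t| ^ (2 * n)) :=
      setLIntegral_congr_fun measurableSet_Ioc fun t ht => by
        rw [hGG' t (Ioc_subset_Icc_self ht), hFF' t (Ioc_subset_Icc_self ht)]
    rw [e, lintegral_eq_zero_iff (by fun_prop)] at h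
    have hae : G' =ᵐ[volume.restrict (Icc 0 T)] F' := by
      rw [← restrict_Ioc_eq_restrict_Icc]
      filter_upwards [h] with t ht
      simp only [Pi.zero_apply, ENNReal.ofReal_eq_zero] at ht
      have h1 : |G' t - F' t| ^ (2 * n) = 0 := le_antisymm ht (by positivity)
      have h2 := pow_eq_zero_iff (by omega) |>.1 h1
      exact sub_eq_zero.1 (abs_eq_zero.1 h2)
    have hEq := Measure.eqOn_Icc_of_ae_eq volume hT.ne hae hG'c.continuousOn hF'c.continuousOn
    intro t ht
    rw [hGG' t ht, hFF' t ht, hEq ht]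
  have hcancel : ∀ x y : ℝ≥0∞, x ≠ ∞ → x + y ≤ x → y = 0 := fun x y hx h => by
    have : x + y ≤ x + 0 := by simpa using h
    simpa using (ENNReal.add_le_add_iff_left hx).1 this
  refine ⟨hF2ac, hrun', ?_, fun G hG => add_le_add (hrun' G hG) (hterm G), ?_⟩
  · intro G hG hmin
    exact huniq G hG (hcancel _ _ hrunfin ((hrun G hG).trans (hmin F₂ hF2ac)))
  · intro G hG hmin
    refine huniq G hG (hcancel _ _ (ENNReal.add_ne_top.2 ⟨hrunfin, htermfin⟩) ?_)
    refine le_trans ?_ (hmin F₂ hF2ac)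
    rw [add_right_comm]
    exact add_le_add (hrun G hG) (hterm G)
end
end

section
/- (Odd-power Euler–Lagrange equation for a Gaussian law.) Let μ be the Gaussian measure on ℝ with mean m ∈ ℝ and variance v ≥ 0 (the Dirac mass at m when v = 0), and let n ≥ 1 be an integer. Then for x ∈ ℝ, ∫_ℝ (x − ζ)^{2n−1} dμ(ζ) = 0 if and only if x = m; equivalently, x = m is the unique real root of the function x ↦ ∫_ℝ (x − ζ)^{2n−1} dμ(ζ). -/
open MeasureTheory
open scoped ENNReal NNReal

noncomputable section

theorem aux_int (m : ℝ) (v : ℝ≥0) (k : ℕ) (x : ℝ) :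
    Integrable (fun ζ : ℝ => (x - ζ) ^ k) (ProbabilityTheory.gaussianReal m v) := by
  have h : MemLp (fun ζ : ℝ => x - ζ) (k : ℝ≥0∞) (ProbabilityTheory.gaussianReal m v) :=
    (memLp_const x).sub
      (ProbabilityTheory.memLp_id_gaussianReal' (k : ℝ≥0∞) (ENNReal.natCast_ne_top k))
  have h2 := h.integrable_norm_pow'
  refine h2.mono' (by fun_prop) (Filter.Eventually.of_forall fun ζ => ?_)
  simp

theorem aux_strict (m : ℝ) (v : ℝ≥0) (k : ℕ) (hk : Odd k) :
    StrictMono fun x : ℝ => ∫ ζ, (x - ζ) ^ k ∂(ProbabilityTheory.gaussianReal m v) := by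
  intro a b hab
  have hlt : ∀ ζ : ℝ, 0 < (b - ζ) ^ k - (a - ζ) ^ k := fun ζ =>
    sub_pos.2 (hk.strictMono_pow (by linarith : a - ζ < b - ζ))
  have hpos : 0 < ∫ ζ, ((b - ζ) ^ k - (a - ζ) ^ k) ∂(ProbabilityTheory.gaussianReal m v) := by
    rw [integral_pos_iff_support_of_nonneg (fun ζ => (hlt ζ).le)
      ((aux_int m v k b).sub (aux_int m v k a))]
    have : Function.support (fun ζ : ℝ => (b - ζ) ^ k - (a - ζ) ^ k) = Set.univ := by
      ext ζ
      simpa only [Function.mem_support, Set.mem_univ, iff_true] using (hlt ζ).ne'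
    rw [this]
    simp
  rw [integral_sub (aux_int m v k b) (aux_int m v k a)] at hpos
  exact sub_pos.1 hpos

theorem aux_zero (m : ℝ) (v : ℝ≥0) (k : ℕ) (hk : Odd k) :
    ∫ ζ, (m - ζ) ^ k ∂(ProbabilityTheory.gaussianReal m v) = 0 := by
  have h : (ProbabilityTheory.gaussianReal m v).map (fun ζ => 2 * m - ζ)
      = ProbabilityTheory.gaussianReal m v := by
    rw [ProbabilityTheory.gaussianReal_map_const_sub]
    congr 1
    ring
  have h1 : ∫ ζ, (m - ζ) ^ k ∂(ProbabilityTheory.gaussianReal m v)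
      = ∫ ζ, (m - (2 * m - ζ)) ^ k ∂(ProbabilityTheory.gaussianReal m v) := by
    conv_lhs => rw [← h]
    rw [integral_map (by fun_prop) (by fun_prop)]
  have h2 : ∀ ζ : ℝ, (m - (2 * m - ζ)) ^ k = -(m - ζ) ^ k := fun ζ => by
    rw [← hk.neg_pow]
    congr 1
    ring
  simp only [h2, integral_neg] at h1
  linarith

/-- for the Gaussian measure `μ = gaussianReal m v` (a Dirac mass at `m`
when `v = 0`) and `n ≥ 1`, the odd-power Euler–Lagrange function
`x ↦ ∫ (x − ζ)^{2n−1} dμ(ζ)` vanishes exactly at `x = m`. -/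
theorem stmt_14 (m : ℝ) (v : ℝ≥0) (n : ℕ) (hn : 1 ≤ n) (x : ℝ) :
    (∫ ζ, (x - ζ) ^ (2 * n - 1) ∂(ProbabilityTheory.gaussianReal m v)) = 0 ↔ x = m := by
  have hk : Odd (2 * n - 1) := ⟨n - 1, by omega⟩
  constructor
  · intro h
    exact (aux_strict m v _ hk).injective (h.trans (aux_zero m v _ hk).symm)
  · rintro rfl
    exact aux_zero _ v _ hk
end
end
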